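/- Fix an integer d ≥ 2, an index n ∈ {1,…,2d+2}, and a finite (possibly empty) set Σ of primes. Let V_Σ := {C ∈ 𝒫 : p does not divide 𝔯(C) for every p ∈ Σ, and p^d does not divide 𝔯(C) for every prime p}. Then the n-th weak box density μ_n(V_Σ) exists (the lower and upper n-th weak box densities agree) and equals (∏_{p∈Σ} π_p^{(1)})·(∏_{p∉Σ} π_p^{(d)}), where the infinite product over primes p ∉ Σ is the limit of the partial products over p ≤ Z, p ∉ Σ, as Z → ∞. -/

import Mathlib

open Filter MvPolynomial

noncomputable section

/-- The `2d × 2d` Sylvester matrix of the two generic binary forms of degree `d`,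
with entries taken from the coordinates of `Q` (the first `d+1` coordinates of `Q`
are the coefficients of `F`, the last `d+1` ones those of `G`). -/
def sylvesterMat (d : ℕ) {R : Type*} [CommRing R] (Q : Fin (2 * d + 2) → R) :
    Matrix (Fin (2 * d)) (Fin (2 * d)) R :=
  Matrix.of fun i j =>
    if hi : (i : ℕ) < d then
      if h : (i : ℕ) ≤ (j : ℕ) ∧ (j : ℕ) ≤ (i : ℕ) + d then
        Q ⟨(j : ℕ) - (i : ℕ), by omega⟩
      else 0
    else
      if h : (i : ℕ) - d ≤ (j : ℕ) ∧ (j : ℕ) ≤ (i : ℕ) then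
        Q ⟨d + 1 + ((j : ℕ) - ((i : ℕ) - d)), by omega⟩
      else 0

/-- The generic resultant polynomial `𝔯 ∈ ℤ[x₀,…,x_d,y₀,…,y_d]`:
the determinant of the Sylvester matrix of the generic binary forms of degree `d`. -/
def resPoly (d : ℕ) : MvPolynomial (Fin (2 * d + 2)) ℤ :=
  Matrix.det (sylvesterMat d fun i => X i)

/-- Evaluation `𝔯(Q)` of the generic resultant at a tuple `Q` with entries in a
commutative ring (i.e. evaluation of the image of `𝔯` under the coefficient map `ℤ → R`). -/
def resEval (d : ℕ) {R : Type*} [CommRing R] (Q : Fin (2 * d + 2) → R) : R :=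
  aeval Q (resPoly d)

/-- The set `𝒫 ⊆ ℤ^{2d+2}` identified with `ℙ^{2d+1}(ℚ)`: integer tuples with gcd `1`
whose first nonzero coordinate is positive. -/
def projPts (d : ℕ) : Set (Fin (2 * d + 2) → ℤ) :=
  {C | Finset.univ.gcd C = 1 ∧ ∃ i, 0 < C i ∧ ∀ j, j < i → C j = 0}

/-- The box of integer tuples with `|xᵢ| ≤ rᵢ` for all `i`. -/
def box {m : ℕ} (r : Fin m → ℝ) : Set (Fin m → ℤ) :=
  {x | ∀ i, |(x i : ℝ)| ≤ r i}

/-- The value `ζ(k)` of the Riemann zeta function at an integer `k` (for `k ≥ 2`). -/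
def zetaVal (k : ℕ) : ℝ := ∑' n : ℕ+, (1 : ℝ) / ((n : ℕ) : ℝ) ^ k

/-- The local factor `π_p^{(k)}`. -/
def piLocal (d p k : ℕ) : ℝ :=
  (Nat.card {Q : Fin (2 * d + 2) → ZMod (p ^ k) // resEval d Q ≠ 0} : ℝ) /
    ((p : ℝ) ^ ((2 * d + 2) * k) * (1 - 1 / (p : ℝ) ^ (2 * d + 2)))

/-- The set `V_Σ`: tuples in `𝒫` with `d`-power free resultant and resultant
not divisible by any `p ∈ Σ` (good reduction at `Σ`). -/
def VSigma (d : ℕ) (Sig : Finset ℕ) : Set (Fin (2 * d + 2) → ℤ) :=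
  {C | C ∈ projPts d ∧ (∀ p ∈ Sig, ¬ (p : ℤ) ∣ resEval d C) ∧
    ∀ p : ℕ, p.Prime → ¬ (p : ℤ) ^ d ∣ resEval d C}

/-- The ratio `#S(r⃗)/#𝒫(r⃗)` entering the weak box densities. -/
def weakRatio (d : ℕ) (S : Set (Fin (2 * d + 2) → ℤ)) (r : Fin (2 * d + 2) → ℝ) : ℝ :=
  (Nat.card ↥(S ∩ box r) : ℝ) / (Nat.card ↥(projPts d ∩ box r) : ℝ)

lemma resEval_eq_det (d : ℕ) {R : Type*} [CommRing R] (Q : Fin (2 * d + 2) → R) :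
    resEval d Q = (sylvesterMat d Q).det := by
  rw [resEval, resPoly, AlgHom.map_det]
  congr 1
  ext i j
  simp only [AlgHom.mapMatrix_apply, Matrix.map_apply, sylvesterMat, Matrix.of_apply]
  split_ifs <;> simp

lemma map_resEval (d : ℕ) {R S : Type*} [CommRing R] [CommRing S] (φ : R →+* S)
    (Q : Fin (2 * d + 2) → R) : φ (resEval d Q) = resEval d (fun i => φ (Q i)) := by
  rw [resEval_eq_det, resEval_eq_det, RingHom.map_det]
  congr 1
  ext i j
  simp only [RingHom.mapMatrix_apply, Matrix.map_apply, sylvesterMat, Matrix.of_apply]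
  split_ifs <;> simp

lemma resEval_smul (d : ℕ) {R : Type*} [CommRing R] (c : R) (Q : Fin (2 * d + 2) → R) :
    resEval d (fun i => c * Q i) = c ^ (2 * d) * resEval d Q := by
  rw [resEval_eq_det, resEval_eq_det]
  have : sylvesterMat d (fun i => c * Q i) = c • sylvesterMat d Q := by
    ext i j
    simp only [sylvesterMat, Matrix.of_apply, Matrix.smul_apply, smul_eq_mul]
    split_ifs <;> simp
  rw [this, Matrix.det_smul, Fintype.card_fin]

/-- The polynomial of degree at most `d` whose coefficients are `d + 1` consecutive coordinates
of `Q`, starting at position `s`. -/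
def coordPoly (d s : ℕ) {R : Type*} [CommRing R] (Q : ℕ → R) : Polynomial R :=
  ∑ i ∈ Finset.range (d + 1), Polynomial.monomial i (Q (s + i))

lemma coeff_coordPoly (d s : ℕ) {R : Type*} [CommRing R] (Q : ℕ → R) (i : ℕ) :
    (coordPoly d s Q).coeff i = if i ≤ d then Q (s + i) else 0 := by
  simp [coordPoly, Polynomial.coeff_monomial]

lemma natDegree_coordPoly_le (d s : ℕ) {R : Type*} [CommRing R] (Q : ℕ → R) :
    (coordPoly d s Q).natDegree ≤ d := by
  rw [Polynomial.natDegree_le_iff_coeff_eq_zero]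
  intro N hN
  rw [coeff_coordPoly, if_neg (by omega)]

lemma eval_coordPoly (d s : ℕ) {R : Type*} [CommRing R] (Q : ℕ → R) (a : R) :
    (coordPoly d s Q).eval a = ∑ i ∈ Finset.range (d + 1), Q (s + i) * a ^ i := by
  simp [coordPoly, Polynomial.eval_finsetSum]

lemma resEval_eq_resultant (d : ℕ) {R : Type*} [CommRing R] (Q : ℕ → R) :
    resEval d (fun i => Q i) =
      (coordPoly d (d + 1) Q).resultant (coordPoly d 0 Q) d d := by
  rw [resEval_eq_det, Polynomial.resultant, ← Matrix.det_transpose,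
    ← Matrix.det_submatrix_equiv_self (finCongr (two_mul d))]
  congr 1
  ext i j
  simp only [Matrix.transpose_apply, Matrix.submatrix_apply, sylvesterMat, Matrix.of_apply,
    Polynomial.sylvester]
  by_cases hj : (j : ℕ) < d
  · have : finCongr (two_mul d) j = Fin.castAdd d ⟨j, hj⟩ := by ext; simp
    rw [this, Fin.addCases_left, dif_pos hj]
    simp only [finCongr_apply, Fin.val_cast, Set.mem_Icc, coeff_coordPoly]
    by_cases h : (j : ℕ) ≤ i ∧ (i : ℕ) ≤ j + d
    · rw [dif_pos h, if_pos h, if_pos (by omega)]; congr 1; simp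
    · rw [dif_neg h, if_neg h]
  · have : finCongr (two_mul d) j = Fin.natAdd d ⟨j - d, by omega⟩ := by
      ext; simp; omega
    rw [this, Fin.addCases_right, dif_neg hj]
    simp only [finCongr_apply, Fin.val_cast, Set.mem_Icc, coeff_coordPoly]
    by_cases h : (j : ℕ) - d ≤ i ∧ (i : ℕ) ≤ j
    · rw [dif_pos h, if_pos (by omega), if_pos (by omega)]
    · rw [dif_neg h, if_neg (by omega)]

/-- The involution of the index set exchanging the coefficients of the two binary forms. -/
def swapForms (d : ℕ) (i : ℕ) : ℕ :=
  if i ≤ d then i + (d + 1) else if i ≤ 2 * d + 1 then i - (d + 1) else i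

lemma swapForms_swapForms (d i : ℕ) : swapForms d (swapForms d i) = i := by
  unfold swapForms; split_ifs <;> omega

lemma resEval_swapForms (d : ℕ) {R : Type*} [CommRing R] (Q : ℕ → R) :
    resEval d (fun i => Q (swapForms d i)) = (-1) ^ (d * d) * resEval d (fun i => Q i) := by
  rw [resEval_eq_resultant d (fun i => Q (swapForms d i)), resEval_eq_resultant,
    Polynomial.resultant_comm]
  congr 2
  · ext i
    rw [coeff_coordPoly, coeff_coordPoly]
    split_ifs with h
    · congr 1; unfold swapForms; rw [if_pos (by omega)]; omega
    · rfl
  · ext i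
    rw [coeff_coordPoly, coeff_coordPoly]
    split_ifs with h
    · congr 1; unfold swapForms; rw [if_neg (by omega), if_pos (by omega)]; omega
    · rfl

lemma natDegree_resEval_update_le (d : ℕ) {R : Type*} [CommRing R] (Q : Fin (2 * d + 2) → R)
    (n : Fin (2 * d + 2)) :
    (resEval d (Function.update (fun i => Polynomial.C (Q i)) n Polynomial.X)).natDegree ≤ d := by
  rw [resEval_eq_det, Matrix.det_apply]
  refine Polynomial.natDegree_sum_le_of_forall_le _ _ fun σ _ => ?_
  refine (Polynomial.natDegree_smul_le _ _).trans ?_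
  refine (Polynomial.natDegree_prod_le _ _).trans ?_
  have key : ∀ i, (sylvesterMat d (Function.update (fun i => Polynomial.C (Q i)) n Polynomial.X)
      (σ i) i).natDegree ≤ if (((σ i : ℕ) < d) ↔ (n : ℕ) ≤ d) then 1 else 0 := by
    intro i
    have h1 : ∀ j, (Function.update (fun i => Polynomial.C (Q i)) n Polynomial.X j).natDegree ≤
        if j = n then 1 else 0 := by
      intro j
      by_cases h : j = n
      · subst h; simpa using Polynomial.natDegree_X_le
      · simp [h]
    simp only [sylvesterMat, Matrix.of_apply]
    split_ifs with a b c c c c <;> first | (simp; done) | skip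
    all_goals
      refine (h1 _).trans ?_
      split_ifs with e
      · first | omega | (have := congrArg Fin.val e; simp at this; omega)
      · omega
  refine (Finset.sum_le_sum fun i _ => key i).trans ?_
  rw [Equiv.sum_comp σ (fun i : Fin (2 * d) => if (((i : ℕ) < d) ↔ (n : ℕ) ≤ d) then 1 else 0),
    Fin.sum_univ_eq_sum_range (fun i => if ((i < d) ↔ (n : ℕ) ≤ d) then 1 else 0)]
  generalize (n : ℕ) = k
  rw [two_mul, Finset.sum_range_add]
  by_cases hn : k ≤ d
  · simp only [hn, iff_true]
    have : ∀ x ∈ Finset.range d, (if d + x < d then 1 else 0) = 0 := fun x _ => by simp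
    rw [Finset.sum_congr rfl this]
    simp only [Finset.sum_const_zero, add_zero]
    exact (Finset.sum_le_card_nsmul _ _ 1 fun x _ => by split_ifs <;> omega).trans (by simp)
  · simp only [hn, iff_false]
    have : ∀ x ∈ Finset.range d, (if ¬ x < d then 1 else 0) = 0 := fun x hx => by
      simp at hx; simp [hx]
    rw [Finset.sum_congr rfl this]
    simp

lemma update_comp_swapForms (d : ℕ) {R : Type*} (f : ℕ → R) (n : ℕ) (x : R) (i : ℕ) :
    Function.update f n x (swapForms d i) =
      Function.update (fun j => f (swapForms d j)) (swapForms d n) x i := by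
  by_cases h : i = swapForms d n
  · subst h; simp [swapForms_swapForms]
  · have : swapForms d i ≠ n := fun e => h (by rw [← e, swapForms_swapForms])
    simp [Function.update_of_ne, h, this]

lemma exists_coord_eq_zero_of_le {d : ℕ} (hd : 2 ≤ d) {K : Type*} [Field K] [IsAlgClosed K]
    (Q : ℕ → K) {n : ℕ} (hn : n ≤ d)
    (h : ∀ x : K, resEval d (fun i : Fin (2 * d + 2) => Function.update Q n x i) = 0) :
    ∃ j k, j < 2 * d + 2 ∧ k < 2 * d + 2 ∧ j ≠ k ∧ j ≠ n ∧ k ≠ n ∧ Q j = 0 ∧ Q k = 0 := by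
  classical
  by_contra! hcon
  set G := coordPoly d (d + 1) Q with hG
  have hGup : ∀ x, coordPoly d (d + 1) (Function.update Q n x) = G := by
    intro x
    ext i
    rw [hG, coeff_coordPoly, coeff_coordPoly, Function.update_of_ne (by omega)]
  have hG0 : G ≠ 0 := by
    intro h0
    have hc : ∀ i ≤ d, Q (d + 1 + i) = 0 := by
      intro i hi
      have := congrArg (fun q => Polynomial.coeff q i) h0
      simpa [hG, coeff_coordPoly, hi] using this
    exact hcon (d + 1) (d + 1 + 1) (by omega) (by omega) (by omega) (by omega) (by omega)
      (hc 0 (by omega)) (hc 1 (by omega))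
  have heval : ∀ x a, (coordPoly d 0 (Function.update Q n x)).eval a =
      (coordPoly d 0 (Function.update Q n 0)).eval a + x * a ^ n := by
    intro x a
    rw [eval_coordPoly, eval_coordPoly, ← sub_eq_iff_eq_add', ← Finset.sum_sub_distrib,
      Finset.sum_eq_single n]
    · simp
    · intro b _ hb; simp [Function.update_of_ne hb]
    · intro h; simp at h; omega
  have hfin : ∀ a ∈ G.roots.toFinset,
      {x : K | (coordPoly d 0 (Function.update Q n x)).eval a = 0}.Finite := by
    intro a ha
    have hGa : G.eval a = 0 := by simpa [hG0] using ha
    refine Set.Subsingleton.finite fun x hx y hy => ?_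
    by_contra hxy
    simp only [Set.mem_ofPred_eq] at hx hy
    rw [heval] at hx hy
    have h1 : (x - y) * a ^ n = 0 := by linear_combination hx - hy
    have h2 : a ^ n = 0 := by simpa [sub_eq_zero, hxy] using h1
    have hn0 : n ≠ 0 := fun e => by simp [e] at h2
    have ha0 : a = 0 := by simpa [hn0] using h2
    subst ha0
    have h3 : Q (d + 1) = 0 := by
      rw [← Polynomial.coeff_zero_eq_eval_zero, hG, coeff_coordPoly] at hGa
      simpa using hGa
    have h4 : Q 0 = 0 := by
      rw [h2, mul_zero, add_zero, ← Polynomial.coeff_zero_eq_eval_zero, coeff_coordPoly] at hx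
      simpa [Function.update_of_ne (Ne.symm hn0)] using hx
    exact hcon 0 (d + 1) (by omega) (by omega) (by omega) (by omega) (by omega) h4 h3
  have hcover : {x : K | x ≠ 0} ⊆
      ⋃ a ∈ G.roots.toFinset, {x : K | (coordPoly d 0 (Function.update Q n x)).eval a = 0} := by
    intro x hx
    have h1 := h x
    rw [resEval_eq_resultant, hGup] at h1
    set F := coordPoly d 0 (Function.update Q n x) with hF
    have hGd : G.natDegree ≤ d := natDegree_coordPoly_le _ _ _
    have hFd : F.natDegree ≤ d := natDegree_coordPoly_le _ _ _
    obtain ⟨e, he⟩ := Nat.exists_eq_add_of_le hGd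
    have h2 : G.resultant F (G.natDegree + e) d = 0 := by rw [← he]; exact h1
    rw [Polynomial.resultant_add_left_deg _ _ _ _ _ le_rfl,
      Polynomial.resultant_eq_prod_eval _ _ _ hFd (IsAlgClosed.splits G)] at h2
    rcases mul_eq_zero.mp h2 with h3 | h3
    · exfalso
      have h4 : F.coeff d ^ e = 0 := by simpa using h3
      have he0 : e ≠ 0 := fun h => by simp [h] at h4
      have h5 : F.coeff d = 0 := by simpa [he0] using h4
      rw [hF, coeff_coordPoly, if_pos le_rfl, zero_add] at h5
      have hnd : d ≠ n := fun h => by rw [h, Function.update_self] at h5; exact hx h5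
      rw [Function.update_of_ne hnd] at h5
      have h6 : G.coeff d = 0 := Polynomial.coeff_eq_zero_of_natDegree_lt (by omega)
      rw [hG, coeff_coordPoly, if_pos le_rfl] at h6
      exact hcon d (d + 1 + d) (by omega) (by omega) (by omega) (by omega) (by omega) h5 h6
    · have h4 : (G.roots.map fun a => F.eval a).prod = 0 := by
        simpa [hG0] using h3
      rw [Multiset.prod_eq_zero_iff, Multiset.mem_map] at h4
      obtain ⟨a, ha, ha'⟩ := h4
      simp only [Set.mem_iUnion]
      exact ⟨a, by simpa using ha, ha'⟩
  have hinf : {x : K | x ≠ 0}.Infinite := by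
    have : {x : K | x ≠ 0} = ({0} : Set K)ᶜ := by ext; simp
    rw [this]
    exact (Set.finite_singleton 0).infinite_compl
  exact hinf ((Set.Finite.biUnion (Finset.finite_toSet _) hfin).subset hcover)

/-- If the resultant vanishes identically as a polynomial in one coordinate over a field, then two
other coordinates vanish. -/
lemma exists_coord_eq_zero {d : ℕ} (hd : 2 ≤ d) {K : Type*} [Field K]
    (Q : Fin (2 * d + 2) → K) (n : Fin (2 * d + 2))
    (h : resEval d (Function.update (fun i => Polynomial.C (Q i)) n Polynomial.X) = 0) :
    ∃ j k, j ≠ k ∧ j ≠ n ∧ k ≠ n ∧ Q j = 0 ∧ Q k = 0 := by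
  let ι := algebraMap K (AlgebraicClosure K)
  have hι : ∀ x, ι x = 0 → x = 0 := fun x => (map_eq_zero ι).mp
  let Q' : ℕ → AlgebraicClosure K := fun i => if hi : i < 2 * d + 2 then ι (Q ⟨i, hi⟩) else 0
  have hQ' : ∀ i : Fin (2 * d + 2), Q' i = ι (Q i) := fun i => by simp [Q']
  have h1 : ∀ x, resEval d (fun i : Fin (2 * d + 2) => Function.update Q' n x i) = 0 := by
    intro x
    have := congrArg (Polynomial.eval₂RingHom ι x) h
    rw [map_resEval, map_zero] at this
    rw [← this]
    congr 1
    funext i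
    by_cases hi : i = n
    · subst hi; simp
    · have : (i : ℕ) ≠ n := fun e => hi (Fin.ext e)
      simp [hi, Function.update_of_ne this, hQ']
  have h2 : ∃ j k, j < 2 * d + 2 ∧ k < 2 * d + 2 ∧ j ≠ k ∧ j ≠ n ∧ k ≠ n ∧ Q' j = 0 ∧ Q' k = 0 := by
    by_cases hn : (n : ℕ) ≤ d
    · exact exists_coord_eq_zero_of_le hd Q' hn h1
    · have hs : swapForms d n ≤ d := by
        have := n.2
        unfold swapForms; rw [if_neg hn, if_pos (by omega)]; omega
      obtain ⟨j, k, hj, hk, hjk, hjn, hkn, hj0, hk0⟩ :=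
        exists_coord_eq_zero_of_le hd (fun i => Q' (swapForms d i)) hs (fun x => by
          simp_rw [← update_comp_swapForms]
          rw [resEval_swapForms d (Function.update Q' n x), h1, mul_zero])
      have hlt : ∀ i, i < 2 * d + 2 → swapForms d i < 2 * d + 2 := by
        intro i hi; unfold swapForms; split_ifs <;> omega
      have hinj : ∀ i i', swapForms d i = i' → i = swapForms d i' := by
        rintro i _ rfl; rw [swapForms_swapForms]
      refine ⟨swapForms d j, swapForms d k, hlt _ hj, hlt _ hk, ?_, ?_, ?_, hj0, hk0⟩
      · intro e; apply hjk; rw [hinj _ _ e, swapForms_swapForms]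
      · intro e; exact hjn (hinj _ _ e)
      · intro e; exact hkn (hinj _ _ e)
  obtain ⟨j, k, hj, hk, hjk, hjn, hkn, hj0, hk0⟩ := h2
  refine ⟨⟨j, hj⟩, ⟨k, hk⟩, by simpa using hjk, fun e => hjn (by rw [← e]), fun e =>
      hkn (by rw [← e]),
    hι _ ?_, hι _ ?_⟩
  · rw [← hQ']; exact hj0
  · rw [← hQ']; exact hk0

open Polynomial in
lemma exists_resEval_eq_prod {d : ℕ} (hd : 2 ≤ d) {n : ℕ} (hn : n ≤ d) :
    ∃ Q : ℕ → ℤ, ∃ b : ℕ → ℤ,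
      (∀ i ∈ Finset.range d, ∀ j ∈ Finset.range d, i ≠ j →
        ((i : ℤ) + 1) ^ n * b j - (j + 1) ^ n * b i ≠ 0) ∧
      resEval d (fun i : Fin (2 * d + 2) => Function.update (fun i => Polynomial.C (Q i)) n
          Polynomial.X i) =
        ∏ i ∈ Finset.range d, (Polynomial.C (((i : ℤ) + 1) ^ n) * Polynomial.X +
            Polynomial.C (b i)) := by
  let e : ℕ := if n = 0 then 1 else 0
  have hen : e ≠ n := by simp only [e]; split_ifs <;> omega
  have hed : e ≤ d := by simp only [e]; split_ifs <;> omega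
  let G : ℤ[X] := ∏ i ∈ Finset.range d, (Polynomial.X - Polynomial.C ((i : ℤ) + 1))
  have hGd : G.natDegree = d := by
    simp only [G]
    rw [Polynomial.natDegree_prod_of_monic _ _ fun i _ => Polynomial.monic_X_sub_C _]
    simp only [Polynomial.natDegree_X_sub_C]
    simp
  let Q : ℕ → ℤ := fun i => if i ≤ d then (if i = e then 1 else 0) else G.coeff (i - (d + 1))
  refine ⟨Q, fun i => ((i : ℤ) + 1) ^ e, ?_, ?_⟩
  · intro i _ j _ hij
    beta_reduce
    by_cases h0 : n = 0
    · simp only [h0, e, if_true, pow_zero, pow_one]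
      omega
    · have : e = 0 := by simp [e, h0]
      rw [this, pow_zero, pow_zero, mul_one, mul_one, sub_ne_zero]
      intro h
      have := (pow_left_inj₀ (by positivity) (by positivity) h0).mp h
      omega
  · rw [resEval_eq_resultant]
    have h1 : coordPoly d (d + 1) (Function.update (fun i => Polynomial.C (Q i)) n Polynomial.X) =
        ∏ i ∈ Finset.range d, (Polynomial.X - Polynomial.C (Polynomial.C ((i : ℤ) + 1))) := by
      have : ∏ i ∈ Finset.range d, (Polynomial.X - Polynomial.C (Polynomial.C ((i : ℤ) + 1))) =
          G.map Polynomial.C := by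
        simp [G, Polynomial.map_prod]
      rw [this]
      ext1 i
      rw [coeff_coordPoly, Polynomial.coeff_map]
      split_ifs with hi
      · rw [Function.update_of_ne (by omega)]
        have : ¬ (d + 1 + i ≤ d) := by omega
        simp only [Q, if_neg this, Nat.add_sub_cancel_left]
      · rw [coeff_eq_zero_of_natDegree_lt (by omega), Polynomial.C_0]
    have h2 : (∏ i ∈ Finset.range d, (Polynomial.X - Polynomial.C (Polynomial.C ((i : ℤ) + 1))) :
        ℤ[X][X]).natDegree = d := by
      rw [Polynomial.natDegree_prod_of_monic _ _ fun i _ => Polynomial.monic_X_sub_C _]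
      simp only [Polynomial.natDegree_X_sub_C]
      simp
    have h3 := resultant_prod_left (Finset.range d) (fun i =>
        (Polynomial.X - Polynomial.C (Polynomial.C ((i : ℤ) + 1)) : ℤ[X][X]))
      (coordPoly d 0 (Function.update (fun i => Polynomial.C (Q i)) n Polynomial.X)) d
      (by simp only [Polynomial.leadingCoeff_X_sub_C]; simp)
      (natDegree_coordPoly_le _ _ _)
    rw [h2] at h3
    rw [h1, h3]
    refine Finset.prod_congr rfl fun i _ => ?_
    rw [natDegree_X_sub_C, resultant_X_sub_C_left _ _ _ (natDegree_coordPoly_le _ _ _),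
      eval_coordPoly]
    have h4 : ∀ j ∈ Finset.range (d + 1),
        Function.update (fun i => Polynomial.C (Q i)) n Polynomial.X (0 + j) *
            Polynomial.C ((i : ℤ) + 1) ^ j =
          (if j = n then Polynomial.C (((i : ℤ) + 1) ^ n) * Polynomial.X else 0) +
          (if j = e then Polynomial.C (((i : ℤ) + 1) ^ e) else 0) := by
      intro j hj
      have hj' : j ≤ d := by simpa [Nat.lt_succ_iff] using hj
      rw [zero_add]
      by_cases hjn : j = n
      · subst hjn; rw [Function.update_self, if_pos rfl, if_neg hen.symm, add_zero, mul_comm,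
          Polynomial.C_pow]
      · rw [Function.update_of_ne hjn, if_neg hjn, zero_add]
        by_cases hje : j = e
        · simp [Q, hje, hed]
        · simp [Q, hje, hj']
    rw [Finset.sum_congr rfl h4, Finset.sum_add_distrib, Finset.sum_ite_eq', Finset.sum_ite_eq',
      if_pos (by simp; omega), if_pos (by simp; omega)]

open Polynomial in
lemma resultant_derivative_ne_zero_of_eq_prod {d n : ℕ} {b : ℕ → ℤ}
    (hb : ∀ i ∈ Finset.range d, ∀ j ∈ Finset.range d, i ≠ j →
        ((i : ℤ) + 1) ^ n * b j - (j + 1) ^ n * b i ≠ 0) {f : ℤ[X]}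
    (hf : f = ∏ i ∈ Finset.range d, (Polynomial.C (((i : ℤ) + 1) ^ n) * Polynomial.X +
        Polynomial.C (b i))) :
    f.resultant (derivative f) d (d - 1) ≠ 0 := by
  let ι := Int.castRingHom ℚ
  let l : ℕ → ℚ[X] := fun i => Polynomial.C (((i : ℚ) + 1) ^ n) * Polynomial.X +
      Polynomial.C (b i : ℚ)
  have hpos : ∀ i : ℕ, ((i : ℚ) + 1) ^ n ≠ 0 := fun i => by positivity
  have hfl : f.map ι = ∏ i ∈ Finset.range d, l i := by
    simp [hf, l, Polynomial.map_prod, ι]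
  have hsep : (f.map ι).Separable := by
    rw [hfl]
    refine separable_prod' ?_ ?_
    · intro i hi j hj hij
      have h0 : ((i : ℚ) + 1) ^ n * b j - (j + 1) ^ n * b i ≠ 0 := by
        exact_mod_cast hb i hi j hj hij
      set D := ((i : ℚ) + 1) ^ n * b j - (j + 1) ^ n * b i
      refine ⟨Polynomial.C (-(((j : ℚ) + 1) ^ n) / D), Polynomial.C ((((i : ℚ) + 1) ^ n) / D), ?_⟩
      have : Polynomial.C (-(((j : ℚ) + 1) ^ n) / D) * l i +
          Polynomial.C ((((i : ℚ) + 1) ^ n) / D) * l j =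
          Polynomial.C (D / D) := by
        have e : (D / D) = (-(((j : ℚ) + 1) ^ n) / D) * b i + ((((i : ℚ) + 1) ^ n) / D) * b j := by
          simp only [D]; ring
        rw [e]
        have e2 : Polynomial.C (-(((j : ℚ) + 1) ^ n) / D) * Polynomial.C (((i : ℚ) + 1) ^ n) +
            Polynomial.C ((((i : ℚ) + 1) ^ n) / D) * Polynomial.C (((j : ℚ) + 1) ^ n) = 0 := by
          rw [← Polynomial.C_mul, ← Polynomial.C_mul, ← Polynomial.C_add, ← Polynomial.C_0]; congr
              1; ring
        simp only [l, Polynomial.C_add, Polynomial.C_mul] at e2 ⊢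
        linear_combination Polynomial.X * e2
      rw [this, div_self h0, Polynomial.C_1]
    · intro i _
      refine ⟨0, Polynomial.C (((i : ℚ) + 1) ^ n)⁻¹, ?_⟩
      have : derivative (l i) = Polynomial.C (((i : ℚ) + 1) ^ n) := by
        simp only [l, Polynomial.derivative_add, Polynomial.derivative_C_mul,
            Polynomial.derivative_X,
          Polynomial.derivative_C, mul_one, add_zero]
      rw [this, zero_mul, zero_add, ← Polynomial.C_mul, inv_mul_cancel₀ (hpos i), Polynomial.C_1]
  have hdeg : (f.map ι).natDegree = d := by
    have hl : ∀ i, (l i).natDegree = 1 := fun i => natDegree_linear (hpos i)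
    rw [hfl, natDegree_prod _ _ fun i _ h => by simpa [h] using hl i]
    simp [hl]
  have hdeg' : (derivative (f.map ι)).natDegree = d - 1 := by
    rw [natDegree_derivative, hdeg]
  intro h
  have h1 := resultant_map_map f (derivative f) d (d - 1) ι
  rw [h, map_zero, ← derivative_map] at h1
  have h2 : (f.map ι).resultant (derivative (f.map ι)) = 0 := by rw [hdeg, hdeg', h1]
  exact (resultant_eq_zero_iff.mp h2).2 hsep

lemma exists_resultant_derivative_ne_zero {d : ℕ} (hd : 2 ≤ d) (n : Fin (2 * d + 2)) :
    ∃ Q : Fin (2 * d + 2) → ℤ,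
      (resEval d (Function.update (fun i => Polynomial.C (Q i)) n Polynomial.X)).resultant
        (Polynomial.derivative
          (resEval d (Function.update (fun i => Polynomial.C (Q i)) n Polynomial.X)))
        d (d - 1) ≠ 0 := by
  have hval : ∀ (Q : ℕ → ℤ),
      Function.update (fun i : Fin (2 * d + 2) => Polynomial.C (Q i)) n Polynomial.X =
      fun i : Fin (2 * d + 2) =>
        Function.update (fun i => Polynomial.C (Q i)) (n : ℕ) Polynomial.X i := by
    intro Q
    funext i
    by_cases hi : i = n
    · subst hi; simp
    · have : (i : ℕ) ≠ n := fun e => hi (Fin.ext e)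
      simp [hi, Function.update_of_ne this]
  by_cases hn : (n : ℕ) ≤ d
  · obtain ⟨Q, b, hb, hQ⟩ := exists_resEval_eq_prod hd hn
    refine ⟨fun i => Q i, ?_⟩
    rw [hval]
    exact resultant_derivative_ne_zero_of_eq_prod hb hQ
  · have hs : swapForms d n ≤ d := by
      have := n.2
      unfold swapForms; rw [if_neg hn, if_pos (by omega)]; omega
    obtain ⟨Q, b, hb, hQ⟩ := exists_resEval_eq_prod hd hs
    refine ⟨fun i => Q (swapForms d i), ?_⟩
    rw [hval (fun i => Q (swapForms d i))]
    have h1 := resEval_swapForms d (Function.update (fun i => Polynomial.C (Q i)) (swapForms d n)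
      Polynomial.X)
    simp_rw [update_comp_swapForms, swapForms_swapForms] at h1
    rw [h1]
    have hr := resultant_derivative_ne_zero_of_eq_prod hb hQ
    set f := resEval d (fun i : Fin (2 * d + 2) =>
      Function.update (fun i => Polynomial.C (Q i)) (swapForms d n) Polynomial.X i)
    have hC : ((-1) ^ (d * d) : Polynomial ℤ) = Polynomial.C ((-1) ^ (d * d)) := by simp
    rw [hC, Polynomial.derivative_C_mul, Polynomial.resultant_C_mul_left,
      Polynomial.resultant_C_mul_right]
    exact mul_ne_zero (by simp) (mul_ne_zero (by simp) hr)

/-- The finite set of integer tuples with `|xᵢ| ≤ aᵢ` for all `i`. -/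
def intBox {m : ℕ} (a : Fin m → ℕ) : Finset (Fin m → ℤ) :=
  Fintype.piFinset fun i => Finset.Icc (-(a i : ℤ)) (a i)

lemma mem_intBox {m : ℕ} {a : Fin m → ℕ} {x : Fin m → ℤ} :
    x ∈ intBox a ↔ ∀ i, |x i| ≤ a i := by
  simp [intBox, abs_le]

lemma card_Icc_neg (t : ℕ) : (Finset.Icc (-(t : ℤ)) t).card = 2 * t + 1 := by
  rw [Int.card_Icc]; omega

lemma card_intBox {m : ℕ} (a : Fin m → ℕ) : (intBox a).card = ∏ i, (2 * a i + 1) := by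
  simp only [intBox, Fintype.card_piFinset, card_Icc_neg]

lemma card_intBox_pos {m : ℕ} (a : Fin m → ℕ) : 0 < ((intBox a).card : ℝ) := by
  rw [card_intBox]
  exact_mod_cast Finset.prod_pos fun i _ => by omega

lemma sum_intBox_eq {m : ℕ} (n : Fin (m + 1)) (a : Fin (m + 1) → ℕ) (F : (Fin (m + 1) → ℤ) → ℝ) :
    ∑ c ∈ intBox a, F c = ∑ c ∈ intBox (n.removeNth a),
      ∑ x ∈ Finset.Icc (-(a n : ℤ)) (a n), F (n.insertNth x c) := by
  rw [Finset.sum_comm, ← Finset.sum_product']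
  refine Finset.sum_nbij' (fun c => (c n, n.removeNth c)) (fun q => n.insertNth q.1 q.2)
    ?_ ?_ ?_ ?_ ?_
  · intro c hc
    rw [mem_intBox] at hc
    simp only [Finset.mem_product, Finset.mem_Icc, mem_intBox]
    exact ⟨abs_le.mp (hc n), fun i => hc _⟩
  · rintro ⟨x, c⟩ hq
    simp only [Finset.mem_product, Finset.mem_Icc, mem_intBox] at hq
    rw [mem_intBox, Fin.forall_iff_succAbove n]
    refine ⟨by simpa using abs_le.mpr hq.1, fun i => ?_⟩
    simpa using! hq.2 i
  · intro c _; simp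
  · rintro ⟨x, c⟩ _; simp
  · intro c _; simp

lemma card_intBox_removeNth {m : ℕ} (n : Fin (m + 1)) (a : Fin (m + 1) → ℕ) :
    ((intBox a).card : ℝ) = (intBox (n.removeNth a)).card * (2 * (a n : ℝ) + 1) := by
  rw [card_intBox, card_intBox, Fin.prod_univ_succAbove _ n]
  push_cast
  rw [mul_comm]
  rfl

lemma card_filter_modEq_bounds (t : ℕ) {M : ℕ} (hM : 0 < M) (v : ℤ) :
    ((2 * t + 1 : ℝ) / M - 1 ≤ ((Finset.Icc (-(t : ℤ)) t).filter (fun x => x ≡ v [ZMOD M])).card) ∧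
    (((Finset.Icc (-(t : ℤ)) t).filter (fun x => x ≡ v [ZMOD M])).card ≤
      (2 * t + 1 : ℝ) / M + 1) := by
  have hIcc : Finset.Icc (-(t : ℤ)) t = Finset.Ioc (-(t : ℤ) - 1) t := by
    ext x; simp
  have h := Int.Ioc_filter_modEq_card (-(t : ℤ) - 1) t (r := M) (by exact_mod_cast hM) v
  rw [hIcc]
  set N := ((Finset.Ioc (-(t : ℤ) - 1) t).filter (fun x => x ≡ v [ZMOD M])).card
  have hMq : (0 : ℚ) < M := by exact_mod_cast hM
  set A := ((t : ℤ) - v : ℚ) / ((M : ℤ) : ℚ) with hA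
  set B := ((-(t : ℤ) - 1 : ℤ) - v : ℚ) / ((M : ℤ) : ℚ) with hB
  have hAB : A - B = (2 * t + 1) / M := by
    rw [hA, hB]; push_cast; rw [← sub_div]; congr 1; ring
  have h1 := Int.floor_le A
  have h2 := Int.lt_floor_add_one A
  have h3 := Int.floor_le B
  have h4 := Int.lt_floor_add_one B
  have hle : ⌊B⌋ ≤ ⌊A⌋ := by
    apply Int.floor_mono
    have : (0 : ℚ) ≤ (2 * t + 1) / M := by positivity
    linarith
  have hN : ((N : ℕ) : ℚ) = (⌊A⌋ : ℚ) - ⌊B⌋ := by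
    have : (N : ℤ) = ⌊A⌋ - ⌊B⌋ := by rw [h, max_eq_left (by omega)]
    exact_mod_cast this
  have hl : (2 * t + 1 : ℚ) / M - 1 ≤ N := by rw [hN]; linarith
  have hu : (N : ℚ) ≤ (2 * t + 1 : ℚ) / M + 1 := by rw [hN]; linarith
  constructor
  · have := (Rat.cast_le (K := ℝ)).mpr hl
    push_cast at this
    exact this
  · have := (Rat.cast_le (K := ℝ)).mpr hu
    push_cast at this
    exact this

lemma card_le_of_card_image_le {t M K : ℕ} (hM : 0 < M) (T : Finset ℤ)
    (hT : T ⊆ Finset.Icc (-(t : ℤ)) t)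
    (hK : (T.image (fun x : ℤ => (x : ZMod M))).card ≤ K) :
    (T.card : ℝ) ≤ K * ((2 * t + 1 : ℝ) / M + 1) := by
  have h1 := Finset.card_eq_sum_card_image (fun x : ℤ => (x : ZMod M)) T
  rw [h1]
  push_cast
  have h2 : ∀ r ∈ T.image (fun x : ℤ => (x : ZMod M)),
      ((T.filter (fun x : ℤ => (x : ZMod M) = r)).card : ℝ) ≤ (2 * t + 1 : ℝ) / M + 1 := by
    intro r hr
    obtain ⟨v, _, rfl⟩ := Finset.mem_image.mp hr
    refine le_trans ?_ (card_filter_modEq_bounds t hM v).2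
    exact_mod_cast Finset.card_le_card fun x hx => by
      rw [Finset.mem_filter] at hx ⊢
      exact ⟨hT hx.1, (ZMod.intCast_eq_intCast_iff _ _ _).mp hx.2⟩
  refine (Finset.sum_le_card_nsmul _ _ _ h2).trans ?_
  rw [nsmul_eq_mul]
  have : (0 : ℝ) ≤ (2 * t + 1 : ℝ) / M + 1 := by positivity
  gcongr

lemma card_image_roots_le {p K : ℕ} [Fact p.Prime] {g : Polynomial ℤ} (hK : g.natDegree ≤ K)
    (hg : g.map (Int.castRingHom (ZMod p)) ≠ 0) (T : Finset ℤ) (hT : ∀ x ∈ T, (p : ℤ) ∣ g.eval x) :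
    (T.image (fun x : ℤ => (x : ZMod p))).card ≤ K := by
  refine le_trans (Finset.card_le_card (t := (g.map (Int.castRingHom (ZMod p))).roots.toFinset) ?_)
      ?_
  · intro r hr
    obtain ⟨v, hv, rfl⟩ := Finset.mem_image.mp hr
    rw [Multiset.mem_toFinset, Polynomial.mem_roots hg, Polynomial.IsRoot,
      ← eq_intCast (Int.castRingHom (ZMod p)) v, Polynomial.eval_map_apply, eq_intCast,
      ZMod.intCast_zmod_eq_zero_iff_dvd]
    exact hT v hv
  · exact (Multiset.toFinset_card_le _).trans
      ((Polynomial.card_roots' _).trans (Polynomial.natDegree_map_le.trans hK))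

lemma card_filter_dvd_eval_le {p K : ℕ} (hp : p.Prime) {g : Polynomial ℤ} (hK : g.natDegree ≤ K)
    (hg : g.map (Int.castRingHom (ZMod p)) ≠ 0) (t : ℕ) :
    (((Finset.Icc (-(t : ℤ)) t).filter (fun x => (p : ℤ) ∣ g.eval x)).card : ℝ) ≤
      K * ((2 * t + 1 : ℝ) / p + 1) := by
  have := Fact.mk hp
  exact card_le_of_card_image_le hp.pos _ (Finset.filter_subset _ _)
    (card_image_roots_le hK hg _ fun x hx => (Finset.mem_filter.mp hx).2)

/-- Hensel's lemma bounds the number of simple roots modulo `p ^ 2`. -/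
lemma card_filter_sq_dvd_eval_le {p K : ℕ} (hp : p.Prime) {g : Polynomial ℤ} (hK : g.natDegree ≤ K)
    (hg : g.map (Int.castRingHom (ZMod p)) ≠ 0) (t : ℕ) :
    (((Finset.Icc (-(t : ℤ)) t).filter (fun x => (p : ℤ) ^ 2 ∣ g.eval x ∧
      ¬ (p : ℤ) ∣ g.derivative.eval x)).card : ℝ) ≤ K * ((2 * t + 1 : ℝ) / p ^ 2 + 1) := by
  have := Fact.mk hp
  have hpz : Prime (p : ℤ) := Nat.prime_iff_prime_int.mp hp
  set T := (Finset.Icc (-(t : ℤ)) t).filter (fun x => (p : ℤ) ^ 2 ∣ g.eval x ∧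
      ¬ (p : ℤ) ∣ g.derivative.eval x) with hT
  have h1 : (T.image (fun x : ℤ => (x : ZMod (p ^ 2)))).card ≤
      (T.image (fun x : ℤ => (x : ZMod p))).card := by
    have : T.image (fun x : ℤ => (x : ZMod p)) =
        (T.image (fun x : ℤ => (x : ZMod (p ^ 2)))).image
          (ZMod.castHom (dvd_pow_self p two_ne_zero) (ZMod p)) := by
      rw [Finset.image_image]
      refine Finset.image_congr fun x _ => ?_
      simp
    rw [this]
    refine (Finset.card_image_of_injOn ?_).ge
    intro r hr s hs hrs
    rw [Finset.mem_coe, Finset.mem_image] at hr hs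
    obtain ⟨x, hx, rfl⟩ := hr
    obtain ⟨y, hy, rfl⟩ := hs
    simp only [map_intCast] at hrs
    rw [hT, Finset.mem_filter] at hx hy
    rw [ZMod.intCast_eq_intCast_iff_dvd_sub] at hrs ⊢
    push_cast
    obtain ⟨k, hk⟩ := Polynomial.binomExpansion g x (y - x)
    have e : x + (y - x) = y := by ring
    rw [e] at hk
    have h2 : (p : ℤ) ^ 2 ∣ k * (y - x) ^ 2 := Dvd.dvd.mul_left (pow_dvd_pow_of_dvd hrs 2) _
    have h3 : (p : ℤ) ^ 2 ∣ g.derivative.eval x * (y - x) := by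
      have : g.derivative.eval x * (y - x) = g.eval y - g.eval x - k * (y - x) ^ 2 := by
        rw [hk]; ring
      rw [this]
      exact dvd_sub (dvd_sub hy.2.1 hx.2.1) h2
    exact hpz.pow_dvd_of_dvd_mul_left 2 hx.2.2 h3
  have h2 := card_le_of_card_image_le (t := t) (pow_pos hp.pos 2) T (Finset.filter_subset _ _)
    (h1.trans (card_image_roots_le hK hg T fun x hx =>
      (dvd_pow_self _ two_ne_zero).trans (Finset.mem_filter.mp hx).2.1))
  push_cast at h2
  exact h2

lemma card_filter_eval_eq_zero_le {K : ℕ} {g : Polynomial ℤ} (hK : g.natDegree ≤ K) (hg : g ≠ 0)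
    (s : Finset ℤ) : (s.filter (fun x => g.eval x = 0)).card ≤ K := by
  refine le_trans (Finset.card_le_card (t := g.roots.toFinset) ?_) ?_
  · intro x hx
    simpa [hg] using (Finset.mem_filter.mp hx).2
  · exact (Multiset.toFinset_card_le _).trans ((Polynomial.card_roots' _).trans hK)

lemma exists_primeCounting_mul_le (B : ℕ) {ε : ℝ} (hε : 0 < ε) :
    ∃ T : ℕ, ∀ t ≥ T, ((Nat.primeCounting (B * t) : ℕ) : ℝ) ≤ ε * t := by
  have hlog4 : 0 < Real.log 4 + 1 := by
    have := Real.log_pos (show (1 : ℝ) < 4 by norm_num); linarith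
  rcases Nat.eq_zero_or_pos B with rfl | hB
  · exact ⟨0, fun t _ => by simp; positivity⟩
  have hB' : (0 : ℝ) < B := by exact_mod_cast hB
  have h1 := Chebyshev.eventually_primeCounting_le one_pos
  have h2 := Real.tendsto_log_atTop.eventually_ge_atTop ((Real.log 4 + 1) * B / ε)
  have h3 : Tendsto (fun t : ℕ => ((B * t : ℕ) : ℝ)) atTop atTop :=
    tendsto_natCast_atTop_atTop.comp (tendsto_id.const_mul_atTop' hB)
  obtain ⟨T, hT⟩ := eventually_atTop.mp (h3.eventually (h1.and (h2.and (eventually_gt_atTop 1))))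
  refine ⟨T, fun t ht => ?_⟩
  obtain ⟨a, b, c⟩ := hT t ht
  rw [Nat.floor_natCast] at a
  refine a.trans ?_
  have hl : 0 < Real.log ((B * t : ℕ) : ℝ) := Real.log_pos c
  rw [div_le_iff₀ hl]
  rw [div_le_iff₀ hε] at b
  push_cast at b ⊢
  have := mul_le_mul_of_nonneg_right b (Nat.cast_nonneg (α := ℝ) t)
  linarith

lemma sum_Ioc_filter_prime_inv_sq_le {Z : ℕ} (hZ : Z ≠ 0) (N : ℕ) :
    ∑ p ∈ (Finset.Ioc Z N).filter Nat.Prime, (1 : ℝ) / (p : ℝ) ^ 2 ≤ 1 / (Z : ℝ) := by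
  refine (Finset.sum_le_sum_of_subset_of_nonneg (Finset.filter_subset _ _)
    fun _ _ _ => by positivity).trans ?_
  rcases le_total Z N with h | h
  · have := sum_Ioc_inv_sq_le_sub (α := ℝ) hZ h
    simp only [one_div]
    have h0 : (0 : ℝ) ≤ (N : ℝ)⁻¹ := by positivity
    linarith
  · rw [Finset.Ioc_eq_empty (by omega)]; simp

lemma abs_eval_le {d : ℕ} {f : Polynomial ℤ} (hf : f.natDegree ≤ d) :
    ∃ B : ℕ, 0 < B ∧ ∀ (t : ℕ), 0 < t → ∀ x : ℤ, |x| ≤ t → |f.eval x| ≤ B * (t : ℤ) ^ d := by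
  refine ⟨1 + ∑ i ∈ Finset.range (d + 1), (f.coeff i).natAbs, by omega, fun t ht x hx => ?_⟩
  rw [Polynomial.eval_eq_sum_range' (Nat.lt_succ_of_le hf)]
  refine (Finset.abs_sum_le_sum_abs _ _).trans ?_
  have ht' : (1 : ℤ) ≤ t := by exact_mod_cast ht
  have : ∀ i ∈ Finset.range (d + 1), |f.coeff i * x ^ i| ≤ |f.coeff i| * (t : ℤ) ^ d := by
    intro i hi
    rw [abs_mul, abs_pow]
    have hi' : i ≤ d := by simpa [Nat.lt_succ_iff] using hi
    gcongr
    exact (pow_le_pow_left₀ (abs_nonneg _) hx i).trans (pow_le_pow_right₀ ht' hi')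
  refine (Finset.sum_le_sum this).trans ?_
  rw [← Finset.sum_mul]
  push_cast
  have : (0 : ℤ) ≤ (t : ℤ) ^ d := by positivity
  nlinarith

/-- The contribution `∑ 1 / p` of the primes `p > Z` dividing `a`, truncated at `1`. -/
def tailWeight (Z : ℕ) (a : ℤ) : ℝ :=
  if a = 0 then 1 else min 1 (∑ p ∈ a.natAbs.primeFactors.filter (Z < ·), 1 / (p : ℝ))

lemma tailWeight_nonneg (Z : ℕ) (a : ℤ) : 0 ≤ tailWeight Z a := by
  unfold tailWeight
  split_ifs
  · exact zero_le_one
  · exact le_min zero_le_one (Finset.sum_nonneg fun _ _ => by positivity)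

lemma tailWeight_le_one (Z : ℕ) (a : ℤ) : tailWeight Z a ≤ 1 := by
  unfold tailWeight
  split_ifs
  · exact le_rfl
  · exact min_le_left _ _

open Classical in
lemma card_filter_exists_pow_dvd_le {d : ℕ} (hd : 2 ≤ d) {f u v : Polynomial ℤ} {D : ℤ}
    (hf : f.natDegree ≤ d) (hD : f * u + f.derivative * v = Polynomial.C D) {Z : ℕ} (hZ : Z ≠ 0)
    (hfp : ∀ p : ℕ, p.Prime → Z < p → f.map (Int.castRingHom (ZMod p)) ≠ 0) {ε : ℝ} (hε : 0 < ε) :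
    ∃ T : ℕ, ∀ t ≥ T, (((Finset.Icc (-(t : ℤ)) t).filter
      (fun x => ∃ p : ℕ, p.Prime ∧ Z < p ∧ (p : ℤ) ^ d ∣ f.eval x)).card : ℝ) ≤
        (d * tailWeight Z D + d / Z + ε) * (2 * t + 1) := by
  have htriv : tailWeight Z D = 1 → ∃ T : ℕ, ∀ t ≥ T, (((Finset.Icc (-(t : ℤ)) t).filter
      (fun x => ∃ p : ℕ, p.Prime ∧ Z < p ∧ (p : ℤ) ^ d ∣ f.eval x)).card : ℝ) ≤
        (d * tailWeight Z D + d / Z + ε) * (2 * t + 1) := by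
    intro h
    refine ⟨0, fun t _ => ?_⟩
    have h1 : ((Finset.Icc (-(t : ℤ)) t).filter
      (fun x => ∃ p : ℕ, p.Prime ∧ Z < p ∧ (p : ℤ) ^ d ∣ f.eval x)).card ≤ 2 * t + 1 :=
      (Finset.card_filter_le _ _).trans (card_Icc_neg t).le
    have h2 : (1 : ℝ) ≤ d * tailWeight Z D + d / Z + ε := by
      have h3 : (2 : ℝ) ≤ d := by exact_mod_cast hd
      have h4 : (0 : ℝ) ≤ d / Z := by positivity
      rw [h]; linarith
    calc _ ≤ ((2 * t + 1 : ℕ) : ℝ) := by exact_mod_cast h1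
      _ = 1 * (2 * t + 1 : ℝ) := by push_cast; ring
      _ ≤ _ := by gcongr
  by_cases hD0 : D = 0
  · exact htriv (by simp [tailWeight, hD0])
  set P := D.natAbs.primeFactors.filter (Z < ·) with hP
  by_cases hσ : 1 ≤ ∑ p ∈ P, 1 / (p : ℝ)
  · exact htriv (by rw [tailWeight, if_neg hD0, ← hP, min_eq_left hσ])
  have hw : tailWeight Z D = ∑ p ∈ P, 1 / (p : ℝ) := by
    rw [tailWeight, if_neg hD0, ← hP, min_eq_right (not_le.mp hσ).le]
  have hf0 : f ≠ 0 := by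
    rintro rfl
    simp only [Polynomial.derivative_zero, zero_mul, add_zero] at hD
    exact hD0 (Polynomial.C_eq_zero.mp hD.symm)
  obtain ⟨B, hB, hBt⟩ := abs_eval_le hf
  have hd0 : (0 : ℝ) < d := by exact_mod_cast (by omega : 0 < d)
  obtain ⟨T₁, hT₁⟩ := exists_primeCounting_mul_le B (div_pos hε hd0)
  obtain ⟨T₂, hT₂⟩ := exists_nat_ge ((d * (1 + P.card)) / ε)
  refine ⟨max 1 (max T₁ T₂), fun t ht => ?_⟩
  have ht1 : 1 ≤ t := (le_max_left _ _).trans ht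
  have htT₁ : T₁ ≤ t := (le_max_left _ _).trans ((le_max_right _ _).trans ht)
  have htT₂ : T₂ ≤ t := (le_max_right _ _).trans ((le_max_right _ _).trans ht)
  set I := Finset.Icc (-(t : ℤ)) t with hI
  set R := (Finset.Ioc Z (B * t)).filter Nat.Prime with hR
  have hsub : I.filter (fun x => ∃ p : ℕ, p.Prime ∧ Z < p ∧ (p : ℤ) ^ d ∣ f.eval x) ⊆
      I.filter (fun x => f.eval x = 0) ∪
        (P.biUnion fun p => I.filter (fun x => (p : ℤ) ∣ f.eval x)) ∪
        (R.biUnion fun p => I.filter (fun x => (p : ℤ) ^ 2 ∣ f.eval x ∧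
          ¬ (p : ℤ) ∣ f.derivative.eval x)) := by
    intro x hx
    obtain ⟨hxI, p, hp, hZp, hpd⟩ := Finset.mem_filter.mp hx
    simp only [Finset.mem_union, Finset.mem_biUnion, Finset.mem_filter]
    by_cases h0 : f.eval x = 0
    · exact Or.inl (Or.inl ⟨hxI, h0⟩)
    have hpf : (p : ℤ) ∣ f.eval x := (dvd_pow_self _ (by omega)).trans hpd
    by_cases h1 : (p : ℤ) ∣ f.derivative.eval x
    · refine Or.inl (Or.inr ⟨p, ?_, hxI, hpf⟩)
      have h2 : (p : ℤ) ∣ D := by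
        have := congrArg (Polynomial.eval x) hD
        simp only [Polynomial.eval_add, Polynomial.eval_mul, Polynomial.eval_C] at this
        rw [← this]
        exact dvd_add (hpf.mul_right _) (h1.mul_right _)
      rw [hP, Finset.mem_filter, Nat.mem_primeFactors]
      exact ⟨⟨hp, Int.natCast_dvd.mp h2, by simpa using hD0⟩, hZp⟩
    · refine Or.inr ⟨p, ?_, hxI, (pow_dvd_pow _ hd).trans hpd, h1⟩
      rw [hR, Finset.mem_filter, Finset.mem_Ioc]
      refine ⟨⟨hZp, ?_⟩, hp⟩
      have hxt : |x| ≤ t := abs_le.mpr (Finset.mem_Icc.mp hxI)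
      have h3 : (p : ℤ) ^ d ≤ B * (t : ℤ) ^ d :=
        (Int.le_of_dvd (abs_pos.mpr h0) ((dvd_abs _ _).mpr hpd)).trans (hBt t ht1 x hxt)
      have h4 : p ^ d ≤ (B * t) ^ d := by
        have h5 : p ^ d ≤ B * t ^ d := by exact_mod_cast h3
        refine h5.trans ?_
        rw [mul_pow]
        exact Nat.mul_le_mul_right _ (Nat.le_self_pow (by omega) B)
      exact (Nat.pow_le_pow_iff_left (by omega)).mp h4
  have hc1 : ((I.filter (fun x => f.eval x = 0)).card : ℝ) ≤ d := by
    exact_mod_cast card_filter_eval_eq_zero_le hf hf0 I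
  have hc2 : ((P.biUnion fun p => I.filter (fun x => (p : ℤ) ∣ f.eval x)).card : ℝ) ≤
      d * (tailWeight Z D * (2 * t + 1) + P.card) := by
    refine (Nat.cast_le.mpr Finset.card_biUnion_le).trans ?_
    push_cast
    refine (Finset.sum_le_sum fun p hp => ?_ :
      _ ≤ ∑ p ∈ P, (d : ℝ) * ((2 * t + 1 : ℝ) / p + 1)).trans ?_
    · rw [hP, Finset.mem_filter, Nat.mem_primeFactors] at hp
      exact card_filter_dvd_eval_le hp.1.1 hf (hfp p hp.1.1 hp.2) t
    · rw [← Finset.mul_sum, Finset.sum_add_distrib, hw, Finset.sum_mul]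
      refine le_of_eq ?_
      congr 2
      · exact Finset.sum_congr rfl fun p _ => by ring
      · simp
  have hc3 : ((R.biUnion fun p => I.filter (fun x => (p : ℤ) ^ 2 ∣ f.eval x ∧
          ¬ (p : ℤ) ∣ f.derivative.eval x)).card : ℝ) ≤
      d * (1 / Z * (2 * t + 1) + Nat.primeCounting (B * t)) := by
    refine (Nat.cast_le.mpr Finset.card_biUnion_le).trans ?_
    push_cast
    refine (Finset.sum_le_sum fun p hp => ?_ :
      _ ≤ ∑ p ∈ R, (d : ℝ) * ((2 * t + 1 : ℝ) / p ^ 2 + 1)).trans ?_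
    · rw [hR, Finset.mem_filter, Finset.mem_Ioc] at hp
      exact card_filter_sq_dvd_eval_le hp.2 hf (hfp p hp.2 hp.1.1) t
    · rw [← Finset.mul_sum, Finset.sum_add_distrib]
      have h1 : ∑ p ∈ R, (2 * t + 1 : ℝ) / (p : ℝ) ^ 2 ≤ 1 / Z * (2 * t + 1) := by
        have := sum_Ioc_filter_prime_inv_sq_le hZ (B * t)
        rw [← hR] at this
        calc _ = (∑ p ∈ R, (1 : ℝ) / (p : ℝ) ^ 2) * (2 * t + 1) := by
              rw [Finset.sum_mul]; exact Finset.sum_congr rfl fun p _ => by ring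
          _ ≤ _ := by gcongr
      have h2 : ∑ p ∈ R, (1 : ℝ) ≤ Nat.primeCounting (B * t) := by
        rw [Finset.sum_const, nsmul_eq_mul, mul_one, ← Nat.primesLE_card_eq_primeCounting]
        refine Nat.cast_le.mpr (Finset.card_le_card fun p hp => ?_)
        rw [hR, Finset.mem_filter, Finset.mem_Ioc] at hp
        rw [Nat.mem_primesLE]
        exact ⟨hp.1.2, hp.2⟩
      gcongr
  have hcard := (Finset.card_le_card hsub).trans ((Finset.card_union_le _ _).trans
    (Nat.add_le_add_right (Finset.card_union_le _ _) _))
  have hcard' : ((I.filter (fun x => ∃ p : ℕ, p.Prime ∧ Z < p ∧ (p : ℤ) ^ d ∣ f.eval x)).card : ℝ) ≤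
      d + d * (tailWeight Z D * (2 * t + 1) + P.card) +
        d * (1 / Z * (2 * t + 1) + Nat.primeCounting (B * t)) := by
    refine (Nat.cast_le.mpr hcard).trans ?_
    push_cast
    linarith
  refine hcard'.trans ?_
  have h1 := hT₁ t htT₁
  have h2 : (d * (1 + P.card)) / ε ≤ (t : ℝ) := hT₂.trans (by exact_mod_cast htT₂)
  rw [div_le_iff₀ hε] at h2
  have h3 : d * (Nat.primeCounting (B * t) : ℝ) ≤ ε * t := by
    calc _ ≤ d * (ε / d * t) := by gcongr
      _ = ε * t := by field_simp
  have h4 : (d : ℝ) * (1 / Z * (2 * t + 1)) = d / Z * (2 * t + 1) := by ring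
  nlinarith

lemma card_primeFactors_filter_le {s k : ℕ} (hs : 2 ≤ s) {a : ℤ} (ha : a ≠ 0)
    (h : |a| ≤ (s : ℤ) ^ k) : (a.natAbs.primeFactors.filter (s < ·)).card ≤ k := by
  have h1 : s ^ (a.natAbs.primeFactors.filter (s < ·)).card ≤ a.natAbs := by
    calc _ ≤ ∏ p ∈ a.natAbs.primeFactors.filter (s < ·), p :=
          Finset.pow_card_le_prod _ _ _ fun p hp => (Finset.mem_filter.mp hp).2.le
      _ ≤ ∏ p ∈ a.natAbs.primeFactors, p :=
          Finset.prod_le_prod_of_subset_of_one_le' (Finset.filter_subset _ _)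
            fun p hp _ => (Nat.prime_of_mem_primeFactors hp).one_lt.le
      _ ≤ a.natAbs := Nat.le_of_dvd (Int.natAbs_pos.mpr ha) (Nat.prod_primeFactors_dvd _)
  have h2 : a.natAbs ≤ s ^ k := by
    have : ((a.natAbs : ℕ) : ℤ) ≤ ((s ^ k : ℕ) : ℤ) := by push_cast; simpa using h
    exact_mod_cast this
  exact (Nat.pow_le_pow_iff_right (by omega)).mp (h1.trans h2)

lemma tailWeight_le {Z s k : ℕ} (hs : 2 ≤ s) {a e : ℤ} (he : e ≠ 0)
    (h : |a| ≤ (s : ℤ) ^ k) :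
    tailWeight Z a ≤ tailWeight Z e + (if a = 0 then 1 else 0) +
      ∑ p ∈ (Finset.Ioc Z s).filter (fun p : ℕ => p.Prime ∧ ¬ (p : ℤ) ∣ e),
        (if (p : ℤ) ∣ a then (1 : ℝ) / (p : ℝ) else 0) + k / s := by
  have hs0 : (0 : ℝ) < s := by exact_mod_cast (by omega : 0 < s)
  have hsum : 0 ≤ ∑ p ∈ (Finset.Ioc Z s).filter (fun p : ℕ => p.Prime ∧ ¬ (p : ℤ) ∣ e),
        (if (p : ℤ) ∣ a then (1 : ℝ) / (p : ℝ) else 0) :=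
    Finset.sum_nonneg fun p _ => by split_ifs <;> positivity
  have hk : (0 : ℝ) ≤ k / s := by positivity
  have hte := tailWeight_nonneg Z e
  by_cases ha : a = 0
  · have := tailWeight_le_one Z a
    rw [if_pos ha]
    linarith
  rw [if_neg ha]
  by_cases hσ : 1 ≤ ∑ p ∈ e.natAbs.primeFactors.filter (Z < ·), (1 : ℝ) / (p : ℝ)
  · have h1 : tailWeight Z e = 1 := by rw [tailWeight, if_neg he, min_eq_left hσ]
    have := tailWeight_le_one Z a
    linarith
  rw [tailWeight, if_neg ha, tailWeight, if_neg he, min_eq_right (not_le.mp hσ).le]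
  refine (min_le_right _ _).trans ?_
  rw [← Finset.sum_filter]
  have hsub : a.natAbs.primeFactors.filter (Z < ·) ⊆
      (e.natAbs.primeFactors.filter (Z < ·) ∪
        ((Finset.Ioc Z s).filter (fun p : ℕ => p.Prime ∧ ¬ (p : ℤ) ∣ e)).filter
          (fun p : ℕ => (p : ℤ) ∣ a)) ∪ a.natAbs.primeFactors.filter (s < ·) := by
    intro p hp
    simp only [Finset.mem_union, Finset.mem_filter, Nat.mem_primeFactors, Finset.mem_Ioc,
      Int.natCast_dvd] at hp ⊢
    have he' : e.natAbs ≠ 0 := by simpa using he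
    by_cases h1 : p ∣ e.natAbs
    · exact Or.inl (Or.inl ⟨⟨hp.1.1, h1, he'⟩, hp.2⟩)
    · rcases le_or_gt p s with h2 | h2
      · exact Or.inl (Or.inr ⟨⟨⟨hp.2, h2⟩, hp.1.1, h1⟩, hp.1.2.1⟩)
      · exact Or.inr ⟨hp.1, h2⟩
  have hpos : ∀ p : ℕ, 0 ≤ 1 / (p : ℝ) := fun p => by positivity
  refine (Finset.sum_le_sum_of_subset_of_nonneg hsub fun p _ _ => hpos p).trans ?_
  have hu : ∀ A B : Finset ℕ, ∑ p ∈ A ∪ B, (1 : ℝ) / (p : ℝ) ≤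
      ∑ p ∈ A, (1 : ℝ) / (p : ℝ) + ∑ p ∈ B, (1 : ℝ) / (p : ℝ) := fun A B => by
    rw [← Finset.sum_union_inter]
    exact le_add_of_nonneg_right (Finset.sum_nonneg fun p _ => hpos p)
  have hlast : ∑ p ∈ a.natAbs.primeFactors.filter (s < ·), (1 : ℝ) / (p : ℝ) ≤ k / s := by
    refine (Finset.sum_le_card_nsmul _ _ (1 / (s : ℝ)) fun p hp => ?_).trans ?_
    · have : (s : ℝ) ≤ p := by exact_mod_cast (Finset.mem_filter.mp hp).2.le
      gcongr
    · rw [nsmul_eq_mul, div_eq_mul_one_div (k : ℝ)]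
      have := card_primeFactors_filter_le hs ha h
      gcongr
  have := hu (e.natAbs.primeFactors.filter (Z < ·) ∪
        ((Finset.Ioc Z s).filter (fun p : ℕ => p.Prime ∧ ¬ (p : ℤ) ∣ e)).filter
          (fun p : ℕ => (p : ℤ) ∣ a)) (a.natAbs.primeFactors.filter (s < ·))
  have := hu (e.natAbs.primeFactors.filter (Z < ·))
        (((Finset.Ioc Z s).filter (fun p : ℕ => p.Prime ∧ ¬ (p : ℤ) ∣ e)).filter
          (fun p : ℕ => (p : ℤ) ∣ a))
  linarith

lemma sum_tailWeight_eval_le {K k s Z : ℕ} (hs : 2 ≤ s) (hZ : Z ≠ 0) {g : Polynomial ℤ}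
    (hK : g.natDegree ≤ K) (hb : ∀ x : ℤ, |x| ≤ s → |g.eval x| ≤ (s : ℤ) ^ k) :
    ∑ x ∈ Finset.Icc (-(s : ℤ)) s, tailWeight Z (g.eval x) ≤
      (2 * s + 1) * (tailWeight Z (g.coeff K) + 2 * K / Z + (K + k) / s) := by
  have hs0 : (0 : ℝ) < s := by exact_mod_cast (by omega : 0 < s)
  have hZ0 : (0 : ℝ) < Z := by exact_mod_cast (by omega : 0 < Z)
  have hcard : ∀ r : ℝ, ∑ x ∈ Finset.Icc (-(s : ℤ)) s, r = (2 * s + 1) * r := fun r => by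
    rw [Finset.sum_const, card_Icc_neg, nsmul_eq_mul]; push_cast; ring
  set e := g.coeff K with he
  by_cases he0 : e = 0
  · have h1 : tailWeight Z e = 1 := by rw [tailWeight, if_pos he0]
    refine (Finset.sum_le_sum fun x _ => tailWeight_le_one Z (g.eval x)).trans ?_
    rw [hcard, h1]
    have : (0 : ℝ) ≤ 2 * K / Z + (K + k) / s := by positivity
    gcongr
    linarith
  have hg0 : g ≠ 0 := by
    rintro rfl
    exact he0 (by simp [he])
  refine (Finset.sum_le_sum fun x hx => tailWeight_le hs he0
    (hb x (abs_le.mpr (Finset.mem_Icc.mp hx)))).trans ?_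
  simp only [Finset.sum_add_distrib, hcard]
  have h1 : ∑ x ∈ Finset.Icc (-(s : ℤ)) s, (if g.eval x = 0 then (1 : ℝ) else 0) ≤ K := by
    rw [Finset.sum_boole]
    exact_mod_cast card_filter_eval_eq_zero_le hK hg0 _
  have h2 : ∑ x ∈ Finset.Icc (-(s : ℤ)) s,
      ∑ p ∈ (Finset.Ioc Z s).filter (fun p : ℕ => p.Prime ∧ ¬ (p : ℤ) ∣ e),
        (if (p : ℤ) ∣ g.eval x then (1 : ℝ) / (p : ℝ) else 0) ≤ (2 * s + 1) * (2 * K / Z) := by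
    rw [Finset.sum_comm]
    have h3 : ∀ p ∈ (Finset.Ioc Z s).filter (fun p : ℕ => p.Prime ∧ ¬ (p : ℤ) ∣ e),
        ∑ x ∈ Finset.Icc (-(s : ℤ)) s, (if (p : ℤ) ∣ g.eval x then (1 : ℝ) / (p : ℝ) else 0) ≤
          K * (2 * s + 1) * (1 / (p : ℝ) ^ 2) + K * (1 / Z) := by
      intro p hp
      rw [Finset.mem_filter, Finset.mem_Ioc] at hp
      rw [← Finset.sum_filter, Finset.sum_const, nsmul_eq_mul]
      have hp0 : (0 : ℝ) < p := by exact_mod_cast hp.2.1.pos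
      have hpZ : (Z : ℝ) ≤ p := by exact_mod_cast hp.1.1.le
      have := card_filter_dvd_eval_le hp.2.1 hK (fun h => hp.2.2 ?_) s
      · calc _ ≤ (K * ((2 * s + 1 : ℝ) / p + 1)) * (1 / p) := by gcongr
          _ = K * (2 * s + 1) * (1 / (p : ℝ) ^ 2) + K * (1 / p) := by field_simp
          _ ≤ _ := by gcongr
      · rw [← ZMod.intCast_zmod_eq_zero_iff_dvd, he, ← eq_intCast (Int.castRingHom (ZMod p)),
          ← Polynomial.coeff_map, h, Polynomial.coeff_zero]
    refine (Finset.sum_le_sum h3).trans ?_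
    rw [Finset.sum_add_distrib, ← Finset.mul_sum, Finset.sum_const, nsmul_eq_mul]
    have h4 : ∑ p ∈ (Finset.Ioc Z s).filter (fun p : ℕ => p.Prime ∧ ¬ (p : ℤ) ∣ e),
        (1 : ℝ) / (p : ℝ) ^ 2 ≤ 1 / (Z : ℝ) :=
      (Finset.sum_le_sum_of_subset_of_nonneg
        (Finset.monotone_filter_right _ fun p _ hp => hp.1) fun _ _ _ => by positivity).trans
        (sum_Ioc_filter_prime_inv_sq_le hZ s)
    have h5 : (((Finset.Ioc Z s).filter (fun p : ℕ => p.Prime ∧ ¬ (p : ℤ) ∣ e)).card : ℝ) ≤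
        2 * s + 1 := by
      have : ((Finset.Ioc Z s).filter (fun p : ℕ => p.Prime ∧ ¬ (p : ℤ) ∣ e)).card ≤ s :=
        (Finset.card_filter_le _ _).trans (by simp)
      have : (((Finset.Ioc Z s).filter (fun p : ℕ => p.Prime ∧ ¬ (p : ℤ) ∣ e)).card : ℝ) ≤ s := by
        exact_mod_cast this
      linarith
    calc _ ≤ K * (2 * s + 1 : ℝ) * (1 / Z) + (2 * s + 1) * (K * (1 / Z)) := by gcongr
      _ = _ := by ring
  have h6 : (K : ℝ) ≤ (2 * s + 1) * (K / s) := by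
    rw [mul_div_assoc', le_div_iff₀ hs0]
    nlinarith [Nat.cast_nonneg (α := ℝ) K]
  have h7 : ((K : ℝ) + k) / s = K / s + k / s := add_div _ _ _
  rw [h7]
  nlinarith

lemma exists_abs_eval_le_pow {σ : Type*} (D : MvPolynomial σ ℤ) :
    ∃ B k : ℕ, ∀ s : ℕ, 1 ≤ s → ∀ c : σ → ℤ, (∀ i, |c i| ≤ s) →
      |eval c D| ≤ B * (s : ℤ) ^ k := by
  induction D using MvPolynomial.induction_on with
  | C r => exact ⟨r.natAbs, 0, fun s _ c _ => by simp⟩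
  | add p q hp hq =>
    obtain ⟨B, k, h⟩ := hp
    obtain ⟨B', k', h'⟩ := hq
    refine ⟨B + B', k + k', fun s hs c hc => ?_⟩
    have hs' : (1 : ℤ) ≤ s := by exact_mod_cast hs
    rw [map_add]
    refine (abs_add_le _ _).trans ((add_le_add (h s hs c hc) (h' s hs c hc)).trans ?_)
    push_cast
    rw [add_mul]
    gcongr <;> first | exact hs' | omega
  | mul_X p i hp =>
    obtain ⟨B, k, h⟩ := hp
    refine ⟨B, k + 1, fun s hs c hc => ?_⟩
    rw [map_mul, eval_X, abs_mul, pow_succ, ← mul_assoc]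
    exact mul_le_mul (h s hs c hc) (hc i) (abs_nonneg _) (by positivity)

/-- A polynomial in `m + 1` variables seen as a polynomial in its `n`-th variable. -/
def toUnivariate {m : ℕ} (n : Fin (m + 1)) (D : MvPolynomial (Fin (m + 1)) ℤ) :
    Polynomial (MvPolynomial (Fin m) ℤ) :=
  aeval (n.insertNth (α := fun _ => Polynomial (MvPolynomial (Fin m) ℤ)) Polynomial.X
    (fun j => Polynomial.C (X j))) D

lemma toUnivariate_ne_zero {m : ℕ} (n : Fin (m + 1)) {D : MvPolynomial (Fin (m + 1)) ℤ}
    (hD : D ≠ 0) : toUnivariate n D ≠ 0 := by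
  intro h
  apply hD
  have h1 := congrArg (Polynomial.eval₂RingHom (rename n.succAbove).toRingHom (X n)) h
  rw [toUnivariate, map_aeval, map_zero] at h1
  rw [← h1]
  symm
  convert eval₂_eta D using 2
  simp only [coe_eval₂Hom]
  congr 1
  · exact RingHom.ext_int _ _
  · funext i
    refine Fin.succAboveCases n ?_ (fun j => ?_) i <;> simp

lemma eval_map_toUnivariate {m : ℕ} (n : Fin (m + 1)) (D : MvPolynomial (Fin (m + 1)) ℤ)
    (c : Fin m → ℤ) (x : ℤ) :
    ((toUnivariate n D).map (eval c)).eval x = eval (n.insertNth x c) D := by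
  rw [toUnivariate, ← Polynomial.coe_mapRingHom, ← Polynomial.coe_evalRingHom, ← RingHom.comp_apply,
    map_aeval, coe_eval₂Hom]
  change _ = eval₂ (RingHom.id ℤ) (n.insertNth x c) D
  congr 1
  · exact RingHom.ext_int _ _
  · funext i
    refine Fin.succAboveCases n ?_ (fun j => ?_) i <;> simp

theorem exists_sum_tailWeight_le {m : ℕ} (D : MvPolynomial (Fin m) ℤ) (hD : D ≠ 0) {ε : ℝ}
    (hε : 0 < ε) : ∃ Z₀ S : ℕ, ∀ Z ≥ Z₀, ∀ a : Fin m → ℕ, (∀ i, S ≤ a i) →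
      ∑ c ∈ intBox a, tailWeight Z (eval c D) ≤ ε * (intBox a).card := by
  induction m generalizing ε with
  | zero =>
    obtain ⟨r, rfl⟩ := C_surjective (Fin 0) D
    have hr : r ≠ 0 := by rintro rfl; exact hD (map_zero _)
    refine ⟨r.natAbs, 0, fun Z hZ a _ => ?_⟩
    have : tailWeight Z r = 0 := by
      rw [tailWeight, if_neg hr, Finset.filter_eq_empty_iff.mpr]
      · simp
      · intro p hp
        have := Nat.le_of_mem_primeFactors hp
        omega
    simp only [eval_C, this, Finset.sum_const_zero]
    positivity
  | succ m ih =>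
    obtain ⟨B, k, hB⟩ := exists_abs_eval_le_pow D
    have hlc : ∀ i, (toUnivariate i D).leadingCoeff ≠ 0 := fun i =>
      Polynomial.leadingCoeff_ne_zero.mpr (toUnivariate_ne_zero i hD)
    choose Z₁ S₁ h₁ using fun i => ih _ (hlc i) (half_pos hε)
    set K := Finset.univ.sup fun i => (toUnivariate i D).natDegree with hK
    obtain ⟨Z₂, hZ₂⟩ := exists_nat_ge ((2 * K) / (ε / 4))
    obtain ⟨S₂, hS₂⟩ := exists_nat_ge ((K + (k + 1 : ℕ)) / (ε / 4))
    refine ⟨max (Z₂ + 1) (Finset.univ.sup Z₁), max (max 2 B) (max S₂ (Finset.univ.sup S₁)),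
      fun Z hZ a ha => ?_⟩
    obtain ⟨i, hi⟩ := Finite.exists_max a
    have hZ1 : Z₁ i ≤ Z :=
      (Finset.le_sup (f := Z₁) (Finset.mem_univ i)).trans ((le_max_right _ _).trans hZ)
    have hZ2 : Z₂ + 1 ≤ Z := (le_max_left _ _).trans hZ
    have ha2 : ∀ j, 2 ≤ a j ∧ B ≤ a j ∧ S₂ ≤ a j ∧ Finset.univ.sup S₁ ≤ a j := fun j => by
      have := ha j
      simp only [max_le_iff] at this
      tauto
    obtain ⟨hs2, hsB, hsS, -⟩ := ha2 i
    have hKi : (toUnivariate i D).natDegree ≤ K :=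
      Finset.le_sup (f := fun i => (toUnivariate i D).natDegree) (Finset.mem_univ i)
    have hs0 : (0 : ℝ) < a i := by exact_mod_cast (by omega : 0 < a i)
    have hZ0 : (0 : ℝ) < Z := by exact_mod_cast (by omega : 0 < Z)
    rw [sum_intBox_eq i a, card_intBox_removeNth i a]
    have hin : ∀ c ∈ intBox (i.removeNth a), ∑ x ∈ Finset.Icc (-(a i : ℤ)) (a i),
        tailWeight Z (eval (i.insertNth x c) D) ≤ (2 * a i + 1) *
          (tailWeight Z (eval c (toUnivariate i D).leadingCoeff) + ε / 2) := by
      intro c hc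
      rw [mem_intBox] at hc
      simp only [← eval_map_toUnivariate i D c]
      refine (sum_tailWeight_eval_le (K := (toUnivariate i D).natDegree) (k := k + 1) hs2
        (by omega) Polynomial.natDegree_map_le fun x hx => ?_).trans ?_
      · rw [eval_map_toUnivariate]
        refine (hB (a i) (by omega) _ ?_).trans ?_
        · rw [Fin.forall_iff_succAbove i]
          refine ⟨by simpa using hx, fun j => ?_⟩
          rw [Fin.insertNth_apply_succAbove]
          exact (hc j).trans (by exact_mod_cast hi _)
        · rw [pow_succ']
          gcongr
      · rw [Polynomial.coeff_map, Polynomial.coeff_natDegree]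
        have hKi' : ((toUnivariate i D).natDegree : ℝ) ≤ K := by exact_mod_cast hKi
        have e1 : 2 * ((toUnivariate i D).natDegree : ℝ) / Z ≤ ε / 4 := by
          rw [div_le_iff₀ (by positivity)] at hZ₂
          rw [div_le_iff₀ hZ0]
          have : (Z₂ : ℝ) ≤ Z := by exact_mod_cast (by omega : Z₂ ≤ Z)
          nlinarith
        have e2 : (((toUnivariate i D).natDegree : ℝ) + (k + 1 : ℕ)) / a i ≤ ε / 4 := by
          rw [div_le_iff₀ (by positivity)] at hS₂
          rw [div_le_iff₀ hs0]
          have : (S₂ : ℝ) ≤ a i := by exact_mod_cast hsS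
          nlinarith
        refine mul_le_mul_of_nonneg_left ?_ (by positivity)
        linarith
    refine (Finset.sum_le_sum hin).trans ?_
    rw [← Finset.mul_sum, Finset.sum_add_distrib, Finset.sum_const, nsmul_eq_mul]
    have := h₁ i Z hZ1 (i.removeNth a) fun j =>
      (Finset.le_sup (f := S₁) (Finset.mem_univ i)).trans (ha2 _).2.2.2
    have h2 : (0 : ℝ) ≤ 2 * a i + 1 := by positivity
    nlinarith [mul_le_mul_of_nonneg_left this h2]

lemma card_piFinset_eq {m : ℕ} (a : Fin m → ℕ) (S : Fin m → Finset ℤ) :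
    ((Fintype.piFinset S).card : ℝ) =
      (∏ i, ((S i).card : ℝ) / (2 * a i + 1)) * (intBox a).card := by
  rw [card_intBox, Fintype.card_piFinset]
  push_cast
  rw [← Finset.prod_mul_distrib]
  refine Finset.prod_congr rfl fun i _ => ?_
  field_simp

lemma card_filter_mem_mem {m : ℕ} (a : Fin m → ℕ) {j k : Fin m} (hjk : j ≠ k) (S T : Finset ℤ)
    (hS : S ⊆ Finset.Icc (-(a j : ℤ)) (a j)) (hT : T ⊆ Finset.Icc (-(a k : ℤ)) (a k)) :
    (((intBox a).filter (fun c => c j ∈ S ∧ c k ∈ T)).card : ℝ) =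
      ((S.card : ℝ) / (2 * a j + 1)) * ((T.card : ℝ) / (2 * a k + 1)) * (intBox a).card := by
  have h : (intBox a).filter (fun c => c j ∈ S ∧ c k ∈ T) = Fintype.piFinset
      (fun i => if i = j then S else if i = k then T else Finset.Icc (-(a i : ℤ)) (a i)) := by
    ext c
    simp only [intBox, Finset.mem_filter, Fintype.mem_piFinset]
    constructor
    · rintro ⟨h, hj, hk⟩ i
      split_ifs with h1 h2
      · exact h1 ▸ hj
      · exact h2 ▸ hk
      · exact h i
    · intro h
      have hj := h j
      have hk := h k
      rw [if_pos rfl] at hj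
      rw [if_neg hjk.symm, if_pos rfl] at hk
      refine ⟨fun i => ?_, hj, hk⟩
      have := h i
      split_ifs at this with h1 h2
      · exact h1 ▸ hS hj
      · exact h2 ▸ hT hk
      · exact this
  rw [h, card_piFinset_eq a]
  congr 1
  rw [Finset.prod_eq_mul j k hjk]
  · simp [hjk.symm]
  · rintro c - ⟨h1, h2⟩
    rw [if_neg h1, if_neg h2, card_Icc_neg]
    push_cast
    exact div_self (by positivity)
  · simp
  · simp

lemma card_filter_dvd_ne_zero_le {p : ℕ} (hp : 0 < p) (t : ℕ) :
    (((Finset.Icc (-(t : ℤ)) t).filter (fun x => (p : ℤ) ∣ x ∧ x ≠ 0)).card : ℝ) ≤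
      (2 * t + 1 : ℝ) / p := by
  have h1 := (card_filter_modEq_bounds t hp 0).2
  have h2 : ((Finset.Icc (-(t : ℤ)) t).filter (fun x => (p : ℤ) ∣ x ∧ x ≠ 0)) =
      ((Finset.Icc (-(t : ℤ)) t).filter (fun x => x ≡ 0 [ZMOD p])).erase 0 := by
    ext x
    simp only [Finset.mem_filter, Finset.mem_erase, Int.modEq_zero_iff_dvd]
    tauto
  have h3 : (0 : ℤ) ∈ (Finset.Icc (-(t : ℤ)) t).filter (fun x => x ≡ 0 [ZMOD p]) := by simp
  rw [h2, Finset.card_erase_of_mem h3,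
    Nat.cast_sub (Nat.one_le_iff_ne_zero.mpr (Finset.card_ne_zero_of_mem h3))]
  push_cast
  linarith

open Classical in
lemma card_filter_exists_prime_dvd_le {m : ℕ} (a : Fin m → ℕ) {j k : Fin m} (hjk : j ≠ k) {Z : ℕ}
    (hZ : Z ≠ 0) :
    (((intBox a).filter (fun c => ∃ p : ℕ, p.Prime ∧ Z < p ∧ (p : ℤ) ∣ c j ∧ (p : ℤ) ∣ c k)).card
      : ℝ) ≤ (1 / (Z : ℝ) + 1 / (2 * a j + 1) + 1 / (2 * a k + 1)) * (intBox a).card := by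
  set P := (Finset.Ioc Z (a j)).filter Nat.Prime with hP
  set I := fun i => Finset.Icc (-(a i : ℤ)) (a i) with hI
  set W := fun (i : Fin m) (p : ℕ) => (I i).filter (fun x => (p : ℤ) ∣ x ∧ x ≠ 0) with hW
  have hsub : (intBox a).filter
        (fun c => ∃ p : ℕ, p.Prime ∧ Z < p ∧ (p : ℤ) ∣ c j ∧ (p : ℤ) ∣ c k) ⊆
      (P.biUnion fun p => (intBox a).filter (fun c => c j ∈ W j p ∧ c k ∈ W k p)) ∪
      (intBox a).filter (fun c => c j ∈ ({0} : Finset ℤ) ∧ c k ∈ I k) ∪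
      (intBox a).filter (fun c => c j ∈ I j ∧ c k ∈ ({0} : Finset ℤ)) := by
    intro c hc
    obtain ⟨hca, p, hp, hZp, hj, hk⟩ := Finset.mem_filter.mp hc
    have hI' : ∀ i, c i ∈ I i := fun i => Finset.mem_Icc.mpr (abs_le.mp (mem_intBox.mp hca i))
    simp only [Finset.mem_union, Finset.mem_biUnion, Finset.mem_filter, Finset.mem_singleton]
    by_cases h1 : c j = 0
    · exact Or.inl (Or.inr ⟨hca, h1, hI' k⟩)
    by_cases h2 : c k = 0
    · exact Or.inr ⟨hca, hI' j, h2⟩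
    refine Or.inl (Or.inl ⟨p, ?_, hca, ?_, ?_⟩)
    · rw [hP, Finset.mem_filter, Finset.mem_Ioc]
      refine ⟨⟨hZp, ?_⟩, hp⟩
      have h3 := Int.le_of_dvd (abs_pos.mpr h1) ((dvd_abs _ _).mpr hj)
      exact_mod_cast h3.trans (mem_intBox.mp hca j)
    · exact Finset.mem_filter.mpr ⟨hI' j, hj, h1⟩
    · exact Finset.mem_filter.mpr ⟨hI' k, hk, h2⟩
  have hpos : ∀ i, (0 : ℝ) < 2 * a i + 1 := fun i => by positivity
  have hcardI : ∀ i, ((I i).card : ℝ) / (2 * a i + 1) = 1 := fun i => by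
    rw [hI, card_Icc_neg]
    push_cast
    exact div_self (hpos i).ne'
  have hz : ∀ i, ({0} : Finset ℤ) ⊆ I i := fun i => by simp [hI]
  have hr : ∀ i, ∀ p ∈ P, ((W i p).card : ℝ) / (2 * a i + 1) ≤ 1 / p := by
    intro i p hp
    rw [div_le_iff₀ (hpos i), one_div_mul_eq_div]
    exact card_filter_dvd_ne_zero_le (Finset.mem_filter.mp hp).2.pos _
  have hb : ((P.biUnion fun p =>
      (intBox a).filter (fun c => c j ∈ W j p ∧ c k ∈ W k p)).card : ℝ) ≤
        1 / (Z : ℝ) * (intBox a).card := by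
    refine (Nat.cast_le.mpr Finset.card_biUnion_le).trans ?_
    push_cast
    refine (Finset.sum_le_sum fun p hp => ?_ :
      _ ≤ ∑ p ∈ P, (1 : ℝ) / (p : ℝ) ^ 2 * (intBox a).card).trans ?_
    · rw [card_filter_mem_mem a hjk _ _ (Finset.filter_subset _ _) (Finset.filter_subset _ _)]
      have h1 := hr j p hp
      have h2 := hr k p hp
      have h3 : (0 : ℝ) ≤ 1 / p := by positivity
      calc _ ≤ 1 / (p : ℝ) * (1 / p) * (intBox a).card := by gcongr
        _ = _ := by rw [pow_two, one_div_mul_one_div]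
    · rw [← Finset.sum_mul]
      have := sum_Ioc_filter_prime_inv_sq_le hZ (a j)
      gcongr
  have hcard := (Finset.card_le_card hsub).trans ((Finset.card_union_le _ _).trans
    (Nat.add_le_add_right (Finset.card_union_le _ _) _))
  have hcard' := (Nat.cast_le (α := ℝ)).mpr hcard
  push_cast at hcard'
  rw [card_filter_mem_mem a hjk _ _ (hz j) (subset_refl _),
    card_filter_mem_mem a hjk _ _ (subset_refl _) (hz k), hcardI, hcardI] at hcard'
  simp only [Finset.card_singleton, Nat.cast_one] at hcard'
  refine hcard'.trans ?_
  linarith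

/-- The resultant as a polynomial in its `n`-th coordinate, the other ones being given by `c`. -/
def resInCoord (d : ℕ) (n : Fin (2 * d + 1 + 1)) {R : Type*} [CommRing R]
    (c : Fin (2 * d + 1) → R) : Polynomial R :=
  resEval d (Function.update
    (fun i => Polynomial.C (n.insertNth (α := fun _ => R) 0 c i)) n Polynomial.X)

lemma map_resInCoord (d : ℕ) (n : Fin (2 * d + 1 + 1)) {R S : Type*} [CommRing R] [CommRing S]
    (φ : R →+* S) (c : Fin (2 * d + 1) → R) :
    (resInCoord d n c).map φ = resInCoord d n (fun i => φ (c i)) := by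
  rw [resInCoord, ← Polynomial.coe_mapRingHom, map_resEval, resInCoord]
  congr 1
  funext i
  refine Fin.succAboveCases n ?_ (fun j => ?_) i <;> simp

lemma eval_resInCoord (d : ℕ) (n : Fin (2 * d + 1 + 1)) {R : Type*} [CommRing R]
    (c : Fin (2 * d + 1) → R) (x : R) :
    (resInCoord d n c).eval x = resEval d (n.insertNth (α := fun _ => R) x c) := by
  rw [resInCoord, ← Polynomial.coe_evalRingHom, map_resEval]
  congr 1
  funext i
  refine Fin.succAboveCases n ?_ (fun j => ?_) i <;> simp

lemma natDegree_resInCoord_le (d : ℕ) (n : Fin (2 * d + 1 + 1)) {R : Type*} [CommRing R]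
    (c : Fin (2 * d + 1) → R) : (resInCoord d n c).natDegree ≤ d :=
  natDegree_resEval_update_le d _ n

lemma exists_discriminant {d : ℕ} (hd : 2 ≤ d) (n : Fin (2 * d + 1 + 1)) :
    ∃ D : MvPolynomial (Fin (2 * d + 1)) ℤ, D ≠ 0 ∧ ∀ c : Fin (2 * d + 1) → ℤ,
      ∃ u v : Polynomial ℤ, resInCoord d n c * u + (resInCoord d n c).derivative * v =
        Polynomial.C (eval c D) := by
  set f := resInCoord d n (fun i => (X i : MvPolynomial (Fin (2 * d + 1)) ℤ)) with hf
  have hmap : ∀ c : Fin (2 * d + 1) → ℤ, f.map (eval c) = resInCoord d n c := fun c => by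
    rw [hf, map_resInCoord]
    simp
  refine ⟨f.resultant f.derivative d (d - 1), ?_, fun c => ?_⟩
  · obtain ⟨Q, hQ⟩ := exists_resultant_derivative_ne_zero hd n
    have hQ' : resEval d (Function.update (fun i => Polynomial.C (Q i)) n Polynomial.X) =
        resInCoord d n (Fin.removeNth n Q) := by
      rw [resInCoord]
      congr 1
      funext i
      refine Fin.succAboveCases (n : Fin (2 * d + 1 + 1)) ?_ (fun j => ?_) i <;>
        simp
    intro h
    apply hQ
    rw [hQ', ← hmap, Polynomial.derivative_map, Polynomial.resultant_map_map, h, map_zero]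
  · obtain ⟨u, v, -, -, h⟩ := Polynomial.exists_mul_add_mul_eq_C_resultant (m := d) (n := d - 1)
      f f.derivative (natDegree_resInCoord_le d n _)
      ((Polynomial.natDegree_derivative_le f).trans
        (Nat.sub_le_sub_right (natDegree_resInCoord_le d n _) 1)) (Or.inl (by omega))
    refine ⟨u.map (eval c), v.map (eval c), ?_⟩
    rw [← hmap, Polynomial.derivative_map, ← Polynomial.map_mul, ← Polynomial.map_mul,
      ← Polynomial.map_add, h, Polynomial.map_C]

lemma sum_card_filter_intBox {m : ℕ} (n : Fin (m + 1)) (a : Fin m → ℕ) (t : ℕ)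
    (P : (Fin (m + 1) → ℤ) → Prop) [DecidablePred P] :
    (((intBox (n.insertNth (α := fun _ => ℕ) t a)).filter P).card : ℝ) =
      ∑ c ∈ intBox a, (((Finset.Icc (-(t : ℤ)) t).filter
        (fun x => P (n.insertNth x c))).card : ℝ) := by
  rw [Finset.card_filter]
  push_cast
  rw [sum_intBox_eq n]
  simp only [Fin.removeNth_insertNth, Fin.insertNth_apply_same]
  refine Finset.sum_congr rfl fun c _ => ?_
  rw [Finset.card_filter]
  push_cast
  rfl

open Classical in
/-- Resultants divisible by the `d`-th power of a large prime are rare. -/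
theorem exists_card_filter_exists_pow_dvd_resEval_le {d : ℕ} (hd : 2 ≤ d)
    (n : Fin (2 * d + 1 + 1)) {ε : ℝ} (hε : 0 < ε) :
    ∃ Z₀ S : ℕ, ∀ Z ≥ Z₀, ∀ a : Fin (2 * d + 1) → ℕ, (∀ i, max S Z ≤ a i) → ∃ T, ∀ t ≥ T,
      (((intBox (n.insertNth (α := fun _ => ℕ) t a)).filter (fun C : Fin (2 * d + 2) → ℤ =>
        ∃ p : ℕ, p.Prime ∧ Z < p ∧ (p : ℤ) ^ d ∣ resEval d C)).card : ℝ) ≤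
      ε * (intBox (n.insertNth (α := fun _ => ℕ) t a)).card := by
  obtain ⟨D, hD0, hD⟩ := exists_discriminant hd n
  choose u v huv using hD
  have hd0 : (0 : ℝ) < d := by exact_mod_cast (by omega : 0 < d)
  obtain ⟨Z₁, S, hZS⟩ := exists_sum_tailWeight_le D hD0 (ε := ε / (4 * d)) (by positivity)
  set N : ℝ := (2 * d + 1) ^ 2 with hN
  have hN0 : 0 < N := by positivity
  obtain ⟨Z₂, hZ₂⟩ := exists_nat_ge ((4 * d) / ε)
  obtain ⟨Z₃, hZ₃⟩ := exists_nat_ge (3 * N * 4 / ε)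
  refine ⟨max (max 1 Z₁) (max Z₂ Z₃), S, fun Z hZ a ha => ?_⟩
  simp only [ge_iff_le, max_le_iff] at hZ ha
  obtain ⟨⟨hZ1, hZZ1⟩, hZZ2, hZZ3⟩ := hZ
  have hZ0 : (0 : ℝ) < Z := by exact_mod_cast hZ1
  set bad := (intBox a).filter (fun c => ∃ j k, j ≠ k ∧ ∃ p : ℕ, p.Prime ∧ Z < p ∧
    (p : ℤ) ∣ c j ∧ (p : ℤ) ∣ c k) with hbad
  have hT : ∀ c : Fin (2 * d + 1) → ℤ, c ∉ bad → c ∈ intBox a → ∃ T : ℕ, ∀ t ≥ T,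
      (((Finset.Icc (-(t : ℤ)) t).filter (fun x =>
        ∃ p : ℕ, p.Prime ∧ Z < p ∧ (p : ℤ) ^ d ∣ (resInCoord d n c).eval x)).card : ℝ) ≤
      (d * tailWeight Z (eval c D) + d / Z + ε / 4) * (2 * t + 1) := by
    intro c hc hca
    refine card_filter_exists_pow_dvd_le hd (natDegree_resInCoord_le d n c) (huv c) (by omega)
      (fun p hp hZp h0 => hc ?_) (by positivity)
    have := Fact.mk hp
    rw [map_resInCoord] at h0
    obtain ⟨j, k, hjk, hjn, hkn, hj, hk⟩ := exists_coord_eq_zero hd _ n h0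
    obtain ⟨j, rfl⟩ := Fin.exists_succAbove_eq hjn
    obtain ⟨k, rfl⟩ := Fin.exists_succAbove_eq hkn
    rw [hbad, Finset.mem_filter]
    rw [Fin.insertNth_apply_succAbove, eq_intCast, ZMod.intCast_zmod_eq_zero_iff_dvd] at hj hk
    exact ⟨hca, j, k, fun h => hjk (by rw [h]), p, hp, hZp, hj, hk⟩
  choose! T hT using hT
  have hbadcard : (bad.card : ℝ) ≤ ε / 4 * (intBox a).card := by
    have hsub : bad ⊆ (Finset.univ.filter
        (fun q : Fin (2 * d + 1) × Fin (2 * d + 1) => q.1 ≠ q.2)).biUnion fun q =>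
        (intBox a).filter (fun c => ∃ p : ℕ, p.Prime ∧ Z < p ∧ (p : ℤ) ∣ c q.1 ∧
            (p : ℤ) ∣ c q.2) := by
      intro c hc
      obtain ⟨hca, j, k, hjk, h⟩ := Finset.mem_filter.mp hc
      simp only [Finset.mem_biUnion, Finset.mem_filter]
      exact ⟨(j, k), ⟨Finset.mem_univ _, hjk⟩, hca, h⟩
    refine (Nat.cast_le.mpr ((Finset.card_le_card hsub).trans Finset.card_biUnion_le)).trans ?_
    push_cast
    have hinv : ∀ j, 1 / (2 * (a j : ℝ) + 1) ≤ 1 / Z := fun j => by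
      have : (Z : ℝ) ≤ a j := by exact_mod_cast (ha j).2
      apply one_div_le_one_div_of_le hZ0
      linarith
    refine (Finset.sum_le_card_nsmul _ _ (3 / (Z : ℝ) * (intBox a).card) fun q hq => ?_).trans ?_
    · refine (card_filter_exists_prime_dvd_le a (Finset.mem_filter.mp hq).2 (by omega)).trans ?_
      have h1 := hinv q.1
      have h2 := hinv q.2
      gcongr
      calc _ ≤ 1 / (Z : ℝ) + 1 / Z + 1 / Z := by gcongr
        _ = _ := by ring
    · have h1 : ((Finset.univ.filter
          (fun q : Fin (2 * d + 1) × Fin (2 * d + 1) => q.1 ≠ q.2)).card : ℝ) ≤ N := by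
        have := Finset.card_filter_le (Finset.univ : Finset (Fin (2 * d + 1) × Fin (2 * d + 1)))
          (fun q => q.1 ≠ q.2)
        rw [Finset.card_univ, Fintype.card_prod, Fintype.card_fin] at this
        rw [hN, pow_two]
        exact_mod_cast this
      have h2 : N * (3 / Z) ≤ ε / 4 := by
        rw [div_le_iff₀ hε] at hZ₃
        rw [mul_div_assoc', div_le_iff₀ hZ0]
        have : (Z₃ : ℝ) ≤ Z := by exact_mod_cast hZZ3
        nlinarith
      rw [nsmul_eq_mul, ← mul_assoc]
      have h3 : (0 : ℝ) ≤ 3 / Z := by positivity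
      have h4 := mul_le_mul_of_nonneg_right h1 h3
      exact mul_le_mul_of_nonneg_right (h4.trans h2) (by positivity)
  refine ⟨(intBox a).sup T, fun t ht => ?_⟩
  rw [sum_card_filter_intBox n a t, card_intBox_removeNth n]
  simp only [Fin.removeNth_insertNth, Fin.insertNth_apply_same]
  have hterm : ∀ c ∈ intBox a, (((Finset.Icc (-(t : ℤ)) t).filter (fun x =>
      ∃ p : ℕ, p.Prime ∧ Z < p ∧
        (p : ℤ) ^ d ∣ resEval d (n.insertNth (α := fun _ => ℤ) x c))).card : ℝ) ≤
      ((if c ∈ bad then 1 else 0) + d * tailWeight Z (eval c D) + (d / Z + ε / 4)) *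
        (2 * t + 1) := by
    intro c hc
    have h0 := tailWeight_nonneg Z (eval c D)
    by_cases hcb : c ∈ bad
    · rw [if_pos hcb]
      have h1 := (Finset.card_filter_le (Finset.Icc (-(t : ℤ)) t) (fun x =>
        ∃ p : ℕ, p.Prime ∧ Z < p ∧
          (p : ℤ) ^ d ∣ resEval d (n.insertNth (α := fun _ => ℤ) x c))).trans (card_Icc_neg t).le
      refine (Nat.cast_le.mpr h1).trans ?_
      push_cast
      have h2 : (0 : ℝ) ≤ d * tailWeight Z (eval c D) + (d / Z + ε / 4) := by positivity
      have h3 : (0 : ℝ) ≤ 2 * t + 1 := by positivity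
      nlinarith [mul_nonneg h2 h3]
    · rw [if_neg hcb]
      have := hT c hcb hc t ((Finset.le_sup hc).trans ht)
      simp only [eval_resInCoord] at this
      refine this.trans (le_of_eq (by ring))
  refine (Finset.sum_le_sum hterm).trans ?_
  rw [← Finset.sum_mul, ← mul_assoc]
  refine mul_le_mul_of_nonneg_right ?_ (by positivity)
  rw [Finset.sum_add_distrib, Finset.sum_add_distrib, ← Finset.mul_sum, Finset.sum_boole,
    Finset.sum_const, nsmul_eq_mul]
  have h1 : ((intBox a).filter (· ∈ bad)).card ≤ bad.card :=
    Finset.card_le_card fun c hc => (Finset.mem_filter.mp hc).2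
  have h1' : (((intBox a).filter (· ∈ bad)).card : ℝ) ≤ bad.card := by exact_mod_cast h1
  have h2 := hZS Z hZZ1 a fun i => (ha i).1
  have h3 : (d : ℝ) * ∑ c ∈ intBox a, tailWeight Z (eval c D) ≤ ε / 4 * (intBox a).card := by
    calc _ ≤ (d : ℝ) * (ε / (4 * d) * (intBox a).card) := by gcongr
      _ = _ := by field_simp
  have h4 : (d : ℝ) / Z ≤ ε / 4 := by
    rw [div_le_iff₀ hε] at hZ₂
    rw [div_le_iff₀ hZ0]
    have : (Z₂ : ℝ) ≤ Z := by exact_mod_cast hZZ2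
    nlinarith
  have h5 := mul_le_mul_of_nonneg_left h4 (Nat.cast_nonneg (α := ℝ) (intBox a).card)
  linarith

lemma tendsto_card_filter_zmod_eq {M : ℕ} (hM : 0 < M) (r : ZMod M) :
    Tendsto (fun t : ℕ => (((Finset.Icc (-(t : ℤ)) t).filter
        (fun x : ℤ => (x : ZMod M) = r)).card : ℝ)
      / (2 * t + 1)) atTop (nhds (1 / M)) := by
  obtain ⟨v, rfl⟩ := ZMod.intCast_surjective r
  have hlim : Tendsto (fun t : ℕ => 1 / (2 * (t : ℝ) + 1)) atTop (nhds 0) := by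
    refine squeeze_zero (fun t => by positivity) (fun t => ?_)
      (tendsto_one_div_add_atTop_nhds_zero_nat (𝕜 := ℝ))
    have : (0 : ℝ) ≤ t := t.cast_nonneg
    apply one_div_le_one_div_of_le <;> linarith
  rw [tendsto_iff_norm_sub_tendsto_zero]
  refine squeeze_zero (fun t => norm_nonneg _) (fun t => ?_) hlim
  have h := card_filter_modEq_bounds t hM v
  simp only [ZMod.intCast_eq_intCast_iff]
  set A := (((Finset.Icc (-(t : ℤ)) t).filter (fun x => x ≡ v [ZMOD M])).card : ℝ)
  have hpos : (0 : ℝ) < 2 * t + 1 := by positivity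
  have hM' : (0 : ℝ) < M := by exact_mod_cast hM
  have e : A / (2 * t + 1) - 1 / M = (A - (2 * t + 1) / M) * (1 / (2 * t + 1)) := by field_simp
  rw [Real.norm_eq_abs, e, abs_mul, abs_of_pos (one_div_pos.mpr hpos)]
  refine mul_le_of_le_one_left (by positivity) (abs_le.mpr ⟨?_, ?_⟩) <;> linarith

lemma tendsto_apply_atTop {m : ℕ} (i : Fin m) :
    Tendsto (fun a : Fin m → ℕ => a i) atTop atTop :=
  tendsto_atTop_atTop_of_monotone (Function.monotone_eval i) fun b => ⟨fun _ => b, le_rfl⟩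

open Classical in
lemma tendsto_card_filter_intBox_zmod {m M : ℕ} (hM : 0 < M) (U : Set (Fin m → ZMod M)) :
    Tendsto (fun a : Fin m → ℕ =>
      (((intBox a).filter (fun c => (fun j => (c j : ZMod M)) ∈ U)).card : ℝ) / (intBox a).card)
      atTop (nhds ((Nat.card U : ℝ) / (M : ℝ) ^ m)) := by
  have := NeZero.of_pos hM
  have hcount : ∀ a : Fin m → ℕ,
      (((intBox a).filter (fun c => (fun j => (c j : ZMod M)) ∈ U)).card : ℝ) / (intBox a).card =
      ∑ Q ∈ U.toFinset, ∏ j, ((((Finset.Icc (-(a j : ℤ)) (a j)).filter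
        (fun x : ℤ => (x : ZMod M) = Q j)).card : ℝ) / (2 * a j + 1)) := by
    intro a
    rw [div_eq_iff (card_intBox_pos a).ne', Finset.sum_mul]
    rw [Finset.card_eq_sum_card_fiberwise (f := fun c j => (c j : ZMod M)) (t := U.toFinset)]
    · push_cast
      refine Finset.sum_congr rfl fun Q hQ => ?_
      rw [← card_piFinset_eq]
      congr 2
      ext c
      simp only [intBox, Finset.mem_filter, Fintype.mem_piFinset, funext_iff]
      constructor
      · rintro ⟨⟨h1, -⟩, h2⟩ i
        exact ⟨h1 i, h2 i⟩
      · intro h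
        have hc : (fun j => (c j : ZMod M)) = Q := funext fun i => (h i).2
        exact ⟨⟨fun i => (h i).1, by rw [hc]; exact Set.mem_toFinset.mp hQ⟩, fun i => (h i).2⟩
    · intro c hc
      exact Finset.mem_coe.mpr (Set.mem_toFinset.mpr (Finset.mem_filter.mp hc).2)
  simp only [hcount]
  have hval : (Nat.card U : ℝ) / (M : ℝ) ^ m = ∑ Q ∈ U.toFinset, ∏ _j : Fin m, (1 / (M : ℝ)) := by
    rw [Finset.sum_const, Finset.prod_const, Finset.card_univ, Fintype.card_fin, nsmul_eq_mul,
      Set.toFinset_card, Nat.card_eq_fintype_card, one_div, inv_pow, div_eq_mul_inv]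
  rw [hval]
  exact tendsto_finsetSum _ fun Q _ => tendsto_finsetProd _ fun j _ =>
    (tendsto_card_filter_zmod_eq hM (Q j)).comp (tendsto_apply_atTop j)

open Classical in
lemma tendsto_card_filter_intBox_forall_zmod {m : ℕ} {ι : Type*} [Fintype ι] {M : ι → ℕ}
    (hM : ∀ i, 0 < M i) (hco : Pairwise (Function.onFun Nat.Coprime M))
    (U : ∀ i, Set (Fin m → ZMod (M i))) :
    Tendsto (fun a : Fin m → ℕ =>
      (((intBox a).filter (fun c => ∀ i, (fun j => (c j : ZMod (M i))) ∈ U i)).card : ℝ) /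
        (intBox a).card)
      atTop (nhds (∏ i, (Nat.card (U i) : ℝ) / (M i : ℝ) ^ m)) := by
  let φ := ZMod.prodEquivPi M hco
  let e : (Fin m → ZMod (∏ i, M i)) ≃ ∀ i, Fin m → ZMod (M i) :=
    (Equiv.arrowCongr (Equiv.refl (Fin m)) φ.toEquiv).trans (Equiv.piComm _)
  have he : ∀ (c : Fin m → ℤ) i, e (fun j => (c j : ZMod (∏ i, M i))) i =
      fun j => (c j : ZMod (M i)) := by
    intro c i
    funext j
    change φ (c j : ZMod (∏ i, M i)) i = _
    rw [map_intCast]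
    rfl
  have h := tendsto_card_filter_intBox_zmod (m := m) (Finset.prod_pos fun i _ => hM i)
    (e ⁻¹' Set.univ.pi U)
  simp only [Set.mem_preimage, Set.mem_pi, Set.mem_univ, forall_const, he] at h
  convert h using 2
  have hcard : Nat.card ↥(e ⁻¹' Set.univ.pi U) = ∏ i, Nat.card (U i) := by
    rw [← Nat.card_pi, ← Nat.card_congr (Equiv.Set.univPi U)]
    exact Nat.card_congr (e.subtypeEquiv fun x => Iff.rfl)
  rw [hcard]
  push_cast
  rw [Finset.prod_div_distrib, Finset.prod_pow]

/-- The filter along which weak box densities are computed: the `n`-th coordinate tends to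
infinity first, then the others do. -/
def boxFilter {m : ℕ} (n : Fin m) : Filter (Fin m → ℝ) :=
  Filter.bind atTop fun s => Filter.map (fun t => Function.update s n t) atTop

lemma eventually_boxFilter {m : ℕ} {n : Fin m} {P : (Fin m → ℝ) → Prop} :
    (∀ᶠ r in boxFilter n, P r) ↔ ∀ᶠ s in atTop, ∀ᶠ t in atTop, P (Function.update s n t) := by
  rw [boxFilter, eventually_bind]
  rfl

lemma boxFilter_le_atTop {m : ℕ} (n : Fin m) : boxFilter n ≤ atTop := by
  intro S hS
  obtain ⟨b, hb⟩ := mem_atTop_sets.mp hS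
  change ∀ᶠ r in boxFilter n, r ∈ S
  rw [eventually_boxFilter]
  filter_upwards [eventually_ge_atTop b] with s hs
  filter_upwards [eventually_ge_atTop (b n)] with t ht
  refine hb _ fun i => ?_
  rcases eq_or_ne i n with rfl | hi
  · simpa using ht
  · simpa [Function.update_of_ne hi] using hs i

lemma tendsto_floor_boxFilter {m : ℕ} (n : Fin m) :
    Tendsto (fun (r : Fin m → ℝ) i => ⌊r i⌋₊) (boxFilter n) atTop := by
  refine Tendsto.mono_left ?_ (boxFilter_le_atTop n)
  exact tendsto_atTop_atTop_of_monotone (fun r s h i => Nat.floor_mono (h i))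
    fun b => ⟨fun i => b i, fun i => by simp⟩

lemma liminf_limsup_boxFilter {m : ℕ} (n : Fin m) {F : (Fin m → ℝ) → ℝ} {L : ℝ}
    (h : Tendsto F (boxFilter n) (nhds L)) :
    liminf (fun s => liminf (fun t => F (Function.update s n t)) atTop) atTop = L ∧
    limsup (fun s => limsup (fun t => F (Function.update s n t)) atTop) atTop = L := by
  have key : ∀ ε > 0, ∀ᶠ s : Fin m → ℝ in atTop,
      |liminf (fun t => F (Function.update s n t)) atTop - L| ≤ ε ∧
      |limsup (fun t => F (Function.update s n t)) atTop - L| ≤ ε := by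
    intro ε hε
    have h1 : ∀ᶠ r in boxFilter n, |F r - L| ≤ ε := by
      filter_upwards [h.eventually (Metric.closedBall_mem_nhds L hε)] with r hr
      rwa [← Real.dist_eq]
    rw [eventually_boxFilter] at h1
    filter_upwards [h1] with s hs
    have hlo : ∀ᶠ t in atTop, L - ε ≤ F (Function.update s n t) :=
      hs.mono fun t ht => by linarith [(abs_le.mp ht).1]
    have hup : ∀ᶠ t in atTop, F (Function.update s n t) ≤ L + ε :=
      hs.mono fun t ht => by linarith [(abs_le.mp ht).2]
    have b1 : IsBoundedUnder (· ≤ ·) atTop fun t => F (Function.update s n t) := ⟨_, hup⟩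
    have b2 : IsBoundedUnder (· ≥ ·) atTop fun t => F (Function.update s n t) := ⟨_, hlo⟩
    have h2 := le_liminf_of_le b1.isCoboundedUnder_ge hlo
    have h3 := limsup_le_of_le b2.isCoboundedUnder_le hup
    have h4 := liminf_le_limsup b1 b2
    exact ⟨abs_le.mpr ⟨by linarith, by linarith⟩, abs_le.mpr ⟨by linarith, by linarith⟩⟩
  constructor
  · refine Tendsto.liminf_eq (Metric.nhds_basis_closedBall.tendsto_right_iff.mpr fun ε hε => ?_)
    exact (key ε hε).mono fun s hs => by rw [Metric.mem_closedBall, Real.dist_eq]; exact hs.1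
  · refine Tendsto.limsup_eq (Metric.nhds_basis_closedBall.tendsto_right_iff.mpr fun ε hε => ?_)
    exact (key ε hε).mono fun s hs => by rw [Metric.mem_closedBall, Real.dist_eq]; exact hs.2

/-- A limit of densities controlled by a uniform tail bound. -/
lemma tendsto_of_tail_bound {β : Type*} {l : Filter β} {f : β → ℝ} {g : ℕ → β → ℝ} {α : ℕ → ℝ}
    {L : ℝ} (hg : ∀ Z, Tendsto (g Z) l (nhds (α Z))) (hα : Tendsto α atTop (nhds L))
    (htail : ∀ ε > 0, ∀ᶠ Z in atTop, ∀ᶠ b in l, |g Z b - f b| ≤ ε) :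
    Tendsto f l (nhds L) := by
  refine Metric.nhds_basis_closedBall.tendsto_right_iff.mpr fun ε hε => ?_
  have h3 : 0 < ε / 3 := by positivity
  obtain ⟨Z, h1, h2⟩ := ((htail _ h3).and
    (Metric.nhds_basis_closedBall.tendsto_right_iff.mp hα _ h3)).exists
  filter_upwards [h1, Metric.nhds_basis_closedBall.tendsto_right_iff.mp (hg Z) _ h3] with b hb hb'
  rw [Metric.mem_closedBall, Real.dist_eq] at *
  rw [abs_le] at *
  constructor <;> linarith

lemma exists_tendsto_prod_primesLE {ρ : ℕ → ℝ} (h0 : ∀ p, 0 ≤ ρ p) (h1 : ∀ p, ρ p ≤ 1) :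
    ∃ L, Tendsto (fun Z => ∏ p ∈ (Finset.range (Z + 1)).filter Nat.Prime, ρ p) atTop (nhds L) := by
  refine ⟨_, tendsto_atTop_ciInf (fun Z W hZW => ?_) ⟨0, ?_⟩⟩
  · exact Finset.prod_le_prod_of_subset_of_le_one (by gcongr) (fun p _ => h0 p)
      fun p _ _ => h1 p
  · rintro _ ⟨Z, rfl⟩
    exact Finset.prod_nonneg fun p _ => h0 p

open Classical in
/-- The proportion of the points of `intBox a` satisfying `P`. -/
def boxRatio {m : ℕ} (P : (Fin m → ℤ) → Prop) (a : Fin m → ℕ) : ℝ :=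
  ((intBox a).filter P).card / (intBox a).card

lemma abs_boxRatio_sub_le {m : ℕ} {P Q R : (Fin m → ℤ) → Prop} (hQP : ∀ c, Q c → P c)
    (hPQ : ∀ c, P c → ¬ Q c → R c) (a : Fin m → ℕ) :
    |boxRatio P a - boxRatio Q a| ≤ boxRatio R a := by
  classical
  have hpos := card_intBox_pos a
  have h1 : ((intBox a).filter Q).card ≤ ((intBox a).filter P).card :=
    Finset.card_le_card (Finset.monotone_filter_right _ fun c _ => hQP c)
  have h2 : ((intBox a).filter P).card ≤ ((intBox a).filter Q).card +
      ((intBox a).filter R).card := by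
    refine (Finset.card_le_card fun c hc => ?_).trans (Finset.card_union_le _ _)
    simp only [Finset.mem_union, Finset.mem_filter] at hc ⊢
    by_cases h : Q c
    · exact Or.inl ⟨hc.1, h⟩
    · exact Or.inr ⟨hc.1, hPQ c hc.2 h⟩
  have h1' : (((intBox a).filter Q).card : ℝ) ≤ ((intBox a).filter P).card := by exact_mod_cast h1
  have h2' : (((intBox a).filter P).card : ℝ) ≤ ((intBox a).filter Q).card +
      ((intBox a).filter R).card := by exact_mod_cast h2
  unfold boxRatio
  rw [← sub_div, abs_of_nonneg (div_nonneg (sub_nonneg.mpr (by convert h1')) hpos.le)]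
  refine div_le_div_of_nonneg_right ?_ hpos.le
  rw [sub_le_iff_le_add']
  convert h2'

lemma tendsto_boxRatio_forall_prime {m : ℕ} (k : ℕ → ℕ)
    (V : ∀ p, Set (Fin m → ZMod (p ^ k p))) (Z : ℕ) :
    Tendsto (boxRatio fun c : Fin m → ℤ => ∀ p : ℕ, p.Prime → p ≤ Z →
        (fun j => (c j : ZMod (p ^ k p))) ∈ V p) atTop
      (nhds (∏ p ∈ (Finset.range (Z + 1)).filter Nat.Prime,
        (Nat.card (V p) : ℝ) / ((p ^ k p : ℕ) : ℝ) ^ m)) := by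
  classical
  set s := (Finset.range (Z + 1)).filter Nat.Prime with hs
  have hprime : ∀ p ∈ s, p.Prime := fun p hp => (Finset.mem_filter.mp hp).2
  have h := tendsto_card_filter_intBox_forall_zmod (m := m) (ι := s) (M := fun p => p.1 ^ k p.1)
    (fun p => pow_pos (hprime p.1 p.2).pos _)
    (fun p q hpq => Nat.Coprime.pow _ _ ((Nat.coprime_primes (hprime p.1 p.2)
      (hprime q.1 q.2)).mpr fun h => hpq (Subtype.ext h))) (fun p => V p.1)
  rw [Finset.prod_coe_sort s (fun p => (Nat.card (V p) : ℝ) / ((p ^ k p : ℕ) : ℝ) ^ m)] at h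
  refine h.congr fun a => ?_
  unfold boxRatio
  congr 2
  refine congrArg Finset.card (Finset.filter_congr fun c _ => ?_)
  constructor
  · intro h p hp hpZ
    exact h ⟨p, by rw [hs, Finset.mem_filter, Finset.mem_range]; exact ⟨by omega, hp⟩⟩
  · intro h p
    exact h p.1 (hprime _ p.2) (by
      have := Finset.mem_range.mp (Finset.mem_filter.mp p.2).1
      omega)

lemma eventually_boxFilter_floor {m : ℕ} {n : Fin (m + 1)} {P : (Fin (m + 1) → ℕ) → Prop} {S : ℕ}
    (h : ∀ a : Fin m → ℕ, (∀ i, S ≤ a i) → ∃ T, ∀ t ≥ T, P (n.insertNth t a)) :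
    ∀ᶠ r in boxFilter n, P fun i => ⌊r i⌋₊ := by
  rw [eventually_boxFilter]
  filter_upwards [eventually_ge_atTop fun _ => (S : ℝ)] with s hs
  obtain ⟨T, hT⟩ := h (fun i => ⌊s (n.succAbove i)⌋₊) fun i => Nat.le_floor (hs _)
  filter_upwards [eventually_ge_atTop (T : ℝ)] with t ht
  convert hT ⌊t⌋₊ (Nat.le_floor ht) using 1
  funext i
  refine Fin.succAboveCases n ?_ (fun j => ?_) i <;> simp

lemma resEval_intCast_ne_zero_iff (d p k : ℕ) (c : Fin (2 * d + 2) → ℤ) :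
    resEval d (fun j => (c j : ZMod (p ^ k))) ≠ 0 ↔ ¬ (p : ℤ) ^ k ∣ resEval d c := by
  have h1 := map_resEval d (Int.castRingHom (ZMod (p ^ k))) c
  simp only [eq_intCast] at h1
  rw [← h1, Ne, ZMod.intCast_zmod_eq_zero_iff_dvd]
  push_cast
  rfl

lemma card_resEval_ne_zero_div_le_one (d M : ℕ) :
    (Nat.card {Q : Fin (2 * d + 2) → ZMod M // resEval d Q ≠ 0} : ℝ) / (M : ℝ) ^ (2 * d + 2) ≤
        1 := by
  rcases Nat.eq_zero_or_pos M with rfl | h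
  · simp
  · have := NeZero.of_pos h
    refine div_le_one_of_le₀ ?_ (by positivity)
    have h1 := Finite.card_subtype_le
      (fun Q : Fin (2 * d + 2) → ZMod M => resEval d Q ≠ 0)
    rw [Nat.card_pi] at h1
    simp only [Nat.card_zmod, Finset.prod_const, Finset.card_univ, Fintype.card_fin] at h1
    exact_mod_cast h1

lemma eventually_abs_boxRatio_resEval_sub_le {d : ℕ} (hd : 2 ≤ d) (n : Fin (2 * d + 1 + 1))
    {k : ℕ → ℕ} {K : ℕ} (hk : ∀ p, K < p → k p = d) {ε : ℝ} (hε : 0 < ε) :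
    ∀ᶠ Z : ℕ in atTop, ∀ᶠ r in boxFilter n,
      |boxRatio (fun c : Fin (2 * d + 1 + 1) → ℤ => ∀ p : ℕ, p.Prime → p ≤ Z →
        ¬ (p : ℤ) ^ k p ∣ resEval d c) (fun i => ⌊r i⌋₊) -
      boxRatio (fun c : Fin (2 * d + 1 + 1) → ℤ => ∀ p : ℕ, p.Prime →
        ¬ (p : ℤ) ^ k p ∣ resEval d c) (fun i => ⌊r i⌋₊)| ≤ ε := by
  obtain ⟨Z₀, S, h⟩ := exists_card_filter_exists_pow_dvd_resEval_le hd n hε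
  filter_upwards [eventually_ge_atTop (max Z₀ K)] with Z hZ
  refine eventually_boxFilter_floor (S := max S Z) (P := fun a => |boxRatio
    (fun c : Fin (2 * d + 1 + 1) → ℤ => ∀ p : ℕ, p.Prime → p ≤ Z →
      ¬ (p : ℤ) ^ k p ∣ resEval d c) a -
    boxRatio (fun c : Fin (2 * d + 1 + 1) → ℤ => ∀ p : ℕ, p.Prime →
      ¬ (p : ℤ) ^ k p ∣ resEval d c) a| ≤ ε) fun a ha => ?_
  obtain ⟨T, hT⟩ := h Z ((le_max_left _ _).trans hZ) a ha
  refine ⟨T, fun t ht => (abs_boxRatio_sub_le (R := fun C : Fin (2 * d + 1 + 1) → ℤ =>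
        ∃ p : ℕ, p.Prime ∧ Z < p ∧ (p : ℤ) ^ d ∣ resEval d C)
      (fun c h p hp _ => h p hp) (fun c h1 h2 => ?_) _).trans ?_⟩
  · obtain ⟨p, hp, hpd⟩ : ∃ p : ℕ, p.Prime ∧ (p : ℤ) ^ k p ∣ resEval d c := by
      by_contra hcon
      exact h2 fun p hp h => hcon ⟨p, hp, h⟩
    have hZp : Z < p := by
      by_contra! hpZ
      exact h1 p hp hpZ hpd
    refine ⟨p, hp, hZp, ?_⟩
    rwa [hk p (((le_max_right _ _).trans hZ).trans_lt hZp)] at hpd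
  · rw [boxRatio, div_le_iff₀ (card_intBox_pos _)]
    exact hT t ht

lemma tendsto_boxRatio_resEval_le (d : ℕ) (k : ℕ → ℕ) (Z : ℕ) :
    Tendsto (boxRatio fun c : Fin (2 * d + 1 + 1) → ℤ => ∀ p : ℕ, p.Prime → p ≤ Z →
        ¬ (p : ℤ) ^ k p ∣ resEval d c) atTop
      (nhds (∏ p ∈ (Finset.range (Z + 1)).filter Nat.Prime,
        (Nat.card {Q : Fin (2 * d + 2) → ZMod (p ^ k p) // resEval d Q ≠ 0} : ℝ) /
          ((p ^ k p : ℕ) : ℝ) ^ (2 * d + 2))) := by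
  simp only [← resEval_intCast_ne_zero_iff]
  exact tendsto_boxRatio_forall_prime k
    (fun p => {Q : Fin (2 * d + 1 + 1) → ZMod (p ^ k p) | resEval d Q ≠ 0}) Z

lemma tendsto_boxRatio_resEval {d : ℕ} (hd : 2 ≤ d) (n : Fin (2 * d + 1 + 1)) {k : ℕ → ℕ} {K : ℕ}
    (hk : ∀ p, K < p → k p = d) :
    ∃ α : ℝ, Tendsto (fun Z => ∏ p ∈ (Finset.range (Z + 1)).filter Nat.Prime,
      (Nat.card {Q : Fin (2 * d + 2) → ZMod (p ^ k p) // resEval d Q ≠ 0} : ℝ) /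
        ((p ^ k p : ℕ) : ℝ) ^ (2 * d + 2)) atTop (nhds α) ∧
    Tendsto (fun r : Fin (2 * d + 1 + 1) → ℝ => boxRatio (fun c : Fin (2 * d + 1 + 1) → ℤ =>
      ∀ p : ℕ, p.Prime → ¬ (p : ℤ) ^ k p ∣ resEval d c) fun i => ⌊r i⌋₊)
      (boxFilter n) (nhds α) := by
  obtain ⟨α, hα⟩ := exists_tendsto_prod_primesLE (ρ := fun p =>
    (Nat.card {Q : Fin (2 * d + 2) → ZMod (p ^ k p) // resEval d Q ≠ 0} : ℝ) /
      ((p ^ k p : ℕ) : ℝ) ^ (2 * d + 2)) (fun p => by positivity)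
      (fun p => card_resEval_ne_zero_div_le_one d (p ^ k p))
  exact ⟨α, hα, tendsto_of_tail_bound
    (fun Z => (tendsto_boxRatio_resEval_le d k Z).comp (tendsto_floor_boxFilter n)) hα
    fun ε hε => eventually_abs_boxRatio_resEval_sub_le hd n hk hε⟩

lemma half_le_prod_one_sub_inv_pow {N : ℕ} (hN : 3 ≤ N) (Z : ℕ) :
    1 / 2 ≤ ∏ p ∈ (Finset.range (Z + 1)).filter Nat.Prime, (1 - 1 / (p : ℝ) ^ N) := by
  set s := (Finset.range (Z + 1)).filter Nat.Prime with hs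
  have hprime : ∀ p ∈ s, p.Prime := fun p hp => (Finset.mem_filter.mp hp).2
  have h1 : ∀ p ∈ s, 1 / (p : ℝ) ^ N ≤ 1 / 2 * (1 / (p : ℝ) ^ 2) := by
    intro p hp
    have h2 : (2 : ℝ) ≤ p := by exact_mod_cast (hprime p hp).two_le
    rw [one_div_mul_one_div]
    refine one_div_le_one_div_of_le (by positivity) ?_
    calc (2 : ℝ) * (p : ℝ) ^ 2 ≤ (p : ℝ) * (p : ℝ) ^ 2 := by gcongr
      _ = (p : ℝ) ^ 3 := by ring
      _ ≤ (p : ℝ) ^ N := pow_le_pow_right₀ (by linarith) hN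
  have h2 : ∑ p ∈ s, (1 : ℝ) / (p : ℝ) ^ 2 ≤ 1 := by
    have h := sum_Ioc_filter_prime_inv_sq_le one_ne_zero Z
    simp only [Nat.cast_one, div_one] at h
    refine (Finset.sum_le_sum_of_subset_of_nonneg (fun p hp => ?_)
      fun _ _ _ => by positivity).trans h
    have h3 := Finset.mem_range.mp (Finset.mem_filter.mp hp).1
    exact Finset.mem_filter.mpr ⟨Finset.mem_Ioc.mpr ⟨(hprime p hp).one_lt, by omega⟩, hprime p hp⟩
  have h3 : ∑ p ∈ s, 1 / (p : ℝ) ^ N ≤ 1 / 2 := by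
    refine (Finset.sum_le_sum h1).trans ?_
    rw [← Finset.mul_sum]
    linarith
  have h4 : ∀ t ⊆ s, 1 - ∑ p ∈ t, 1 / (p : ℝ) ^ N ≤ ∏ p ∈ t, (1 - 1 / (p : ℝ) ^ N) ∧
      0 ≤ ∏ p ∈ t, (1 - 1 / (p : ℝ) ^ N) ∧ ∏ p ∈ t, (1 - 1 / (p : ℝ) ^ N) ≤ 1 := by
    intro t
    induction t using Finset.induction_on with
    | empty => simp
    | insert q t hq ih =>
      intro hqt
      obtain ⟨i1, i2, i3⟩ := ih ((Finset.subset_insert _ _).trans hqt)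
      have hq1 : (1 : ℝ) ≤ (q : ℝ) ^ N :=
        one_le_pow₀ (by exact_mod_cast (hprime q (hqt (Finset.mem_insert_self _ _))).one_lt.le)
      have hq2 : 1 / (q : ℝ) ^ N ≤ 1 := div_le_one_of_le₀ hq1 (by positivity)
      have hq3 : 0 ≤ 1 / (q : ℝ) ^ N := by positivity
      rw [Finset.sum_insert hq, Finset.prod_insert hq]
      refine ⟨by nlinarith, mul_nonneg (by linarith) i2, mul_le_one₀ (by linarith) i2 i3⟩
  linarith [(h4 s subset_rfl).1]

lemma tendsto_boxRatio_primitive {m : ℕ} (hm : 2 ≤ m) (n : Fin (m + 1)) :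
    ∃ β : ℝ, 0 < β ∧ Tendsto (fun Z => ∏ p ∈ (Finset.range (Z + 1)).filter Nat.Prime,
      (1 - 1 / (p : ℝ) ^ (m + 1))) atTop (nhds β) ∧
    Tendsto (fun r : Fin (m + 1) → ℝ => boxRatio (fun c : Fin (m + 1) → ℤ =>
      ∀ p : ℕ, p.Prime → ¬ ∀ i, (p : ℤ) ∣ c i) fun i => ⌊r i⌋₊) (boxFilter n) (nhds β) := by
  have hle : ∀ p : ℕ, 1 / (p : ℝ) ^ (m + 1) ≤ 1 := fun p => by
    rcases Nat.eq_zero_or_pos p with rfl | h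
    · simp
    · exact div_le_one_of_le₀ (one_le_pow₀ (by exact_mod_cast h)) (by positivity)
  obtain ⟨β, hβ⟩ := exists_tendsto_prod_primesLE (ρ := fun p => 1 - 1 / (p : ℝ) ^ (m + 1))
    (fun p => sub_nonneg.mpr (hle p)) (fun p => sub_le_self _ (by positivity))
  have hβ0 : 1 / 2 ≤ β := ge_of_tendsto' hβ fun Z => half_le_prod_one_sub_inv_pow (by omega) Z
  have hcard : ∀ p : ℕ, p.Prime → (Nat.card ({Q | Q ≠ 0} : Set (Fin (m + 1) → ZMod (p ^ 1))) : ℝ) /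
      ((p ^ 1 : ℕ) : ℝ) ^ (m + 1) = 1 - 1 / (p : ℝ) ^ (m + 1) := by
    intro p hp
    have := Fact.mk hp
    have h0 : NeZero (p ^ 1) := NeZero.of_pos (pow_pos hp.pos 1)
    have h1 : (0 : ℝ) < (p : ℝ) ^ (m + 1) := pow_pos (by exact_mod_cast hp.pos) _
    have h2 : Nat.card ({Q | Q ≠ 0} : Set (Fin (m + 1) → ZMod (p ^ 1))) =
        (p ^ 1) ^ (m + 1) - 1 := by
      classical
      rw [Nat.card_eq_fintype_card]
      change Fintype.card {Q : Fin (m + 1) → ZMod (p ^ 1) // Q ≠ 0} = _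
      rw [Fintype.card_subtype_compl, Fintype.card_subtype_eq, Fintype.card_fun, ZMod.card,
        Fintype.card_fin]
    rw [h2, pow_one, Nat.cast_sub (Nat.one_le_pow _ _ hp.pos)]
    push_cast
    rw [sub_div, div_self h1.ne']
  refine ⟨β, by linarith, hβ, tendsto_of_tail_bound (g := fun Z r =>
    boxRatio (fun c : Fin (m + 1) → ℤ => ∀ p : ℕ, p.Prime → p ≤ Z →
      (fun j => (c j : ZMod (p ^ 1))) ∈ {Q : Fin (m + 1) → ZMod (p ^ 1) | Q ≠ 0})
      fun i => ⌊r i⌋₊) (fun Z => ?_) hβ fun ε hε => ?_⟩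
  · have h := (tendsto_boxRatio_forall_prime (m := m + 1) (fun _ => 1) (fun p => {Q | Q ≠ 0})
        Z).comp (tendsto_floor_boxFilter n)
    rwa [Finset.prod_congr rfl fun p hp => hcard p (Finset.mem_filter.mp hp).2] at h
  have hmem : ∀ (p : ℕ) (c : Fin (m + 1) → ℤ),
      (fun j => (c j : ZMod (p ^ 1))) ∈ {Q : Fin (m + 1) → ZMod (p ^ 1) | Q ≠ 0} ↔
        ¬ ∀ i, (p : ℤ) ∣ c i := by
    intro p c
    change (fun j => (c j : ZMod (p ^ 1))) ≠ 0 ↔ _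
    rw [Ne, funext_iff]
    simp only [Pi.zero_apply, ZMod.intCast_zmod_eq_zero_iff_dvd, pow_one]
  simp only [hmem]
  obtain ⟨Z₀, hZ₀⟩ := exists_nat_ge (3 / ε)
  filter_upwards [eventually_ge_atTop (max 1 Z₀)] with Z hZ
  have hZ1 : 1 ≤ Z := (le_max_left _ _).trans hZ
  have hZ0 : (0 : ℝ) < Z := by exact_mod_cast hZ1
  have hall : ∀ᶠ r in boxFilter n, ∀ i : Fin (m + 1), Z ≤ ⌊r i⌋₊ :=
    (tendsto_floor_boxFilter n).eventually (eventually_ge_atTop fun _ => Z)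
  filter_upwards [hall] with r hr
  have hjk : (⟨0, by omega⟩ : Fin (m + 1)) ≠ ⟨1, by omega⟩ := by simp
  refine (abs_boxRatio_sub_le (R := fun c : Fin (m + 1) → ℤ => ∃ p : ℕ, p.Prime ∧ Z < p ∧
    (p : ℤ) ∣ c ⟨0, by omega⟩ ∧ (p : ℤ) ∣ c ⟨1, by omega⟩)
      (fun c h p hp _ => h p hp) (fun c h1 h2 => ?_) _).trans ?_
  · obtain ⟨p, hp, hpd⟩ : ∃ p : ℕ, p.Prime ∧ ∀ i, (p : ℤ) ∣ c i := by
      by_contra hcon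
      exact h2 fun p hp h => hcon ⟨p, hp, h⟩
    refine ⟨p, hp, ?_, hpd _, hpd _⟩
    by_contra! hpZ
    exact h1 p hp hpZ hpd
  · rw [boxRatio, div_le_iff₀ (card_intBox_pos _)]
    refine (card_filter_exists_prime_dvd_le _ hjk (by omega)).trans ?_
    refine mul_le_mul_of_nonneg_right ?_ (by positivity)
    have hinv : ∀ i, 1 / (2 * (⌊r i⌋₊ : ℝ) + 1) ≤ 1 / Z := fun i => by
      have : (Z : ℝ) ≤ ⌊r i⌋₊ := by exact_mod_cast hr i
      apply one_div_le_one_div_of_le hZ0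
      linarith
    have h1 : 3 * (1 / (Z : ℝ)) ≤ ε := by
      rw [div_le_iff₀ hε] at hZ₀
      rw [mul_one_div, div_le_iff₀ hZ0]
      have : (Z₀ : ℝ) ≤ Z := by exact_mod_cast (le_max_right _ _).trans hZ
      nlinarith
    have h2 := hinv ⟨0, by omega⟩
    have h3 := hinv ⟨1, by omega⟩
    linarith

/-- The first nonzero coordinate of `C` exists and is positive. -/
def FirstPos {m : ℕ} (C : Fin m → ℤ) : Prop := ∃ i, 0 < C i ∧ ∀ j, j < i → C j = 0

lemma firstPos_neg_iff {m : ℕ} {C : Fin m → ℤ} (hC : C ≠ 0) : FirstPos (-C) ↔ ¬ FirstPos C := by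
  constructor
  · rintro ⟨i, hi, hi'⟩ ⟨j, hj, hj'⟩
    simp only [Pi.neg_apply, Left.neg_pos_iff, neg_eq_zero] at hi hi'
    rcases lt_trichotomy i j with h | rfl | h
    · exact hi.ne (hj' i h)
    · exact hi.asymm hj
    · exact hj.ne' (hi' j h)
  · intro h
    have hex : ∃ i, C i ≠ 0 := by
      by_contra! hcon
      exact hC (funext hcon)
    obtain ⟨i, hi1, hi2⟩ : ∃ i, C i ≠ 0 ∧ ∀ j < i, C j = 0 := by
      obtain ⟨i, hi, hmin⟩ := wellFounded_lt.has_min {i | C i ≠ 0} hex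
      exact ⟨i, hi, fun j hj => by_contra fun hj' => hmin j hj' hj⟩
    refine ⟨i, ?_, fun j hj => by simp [hi2 j hj]⟩
    have : ¬ 0 < C i := fun hpos => h ⟨i, hpos, hi2⟩
    simp only [Pi.neg_apply, Left.neg_pos_iff]
    omega

open Classical in
lemma two_mul_card_filter_firstPos {m : ℕ} {P : (Fin m → ℤ) → Prop} (hneg : ∀ C, P (-C) ↔ P C)
    (h0 : ¬ P 0) (a : Fin m → ℕ) :
    ((intBox a).filter P).card = 2 * ((intBox a).filter fun C => P C ∧ FirstPos C).card := by
  have hne : ∀ C, P C → C ≠ 0 := by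
    rintro C hC rfl
    exact h0 hC
  have h1 : ((intBox a).filter fun C => P C ∧ ¬ FirstPos C).card =
      ((intBox a).filter fun C => P C ∧ FirstPos C).card := by
    refine Finset.card_nbij' (fun C => -C) (fun C => -C) ?_ ?_ (fun _ _ => neg_neg _)
      fun _ _ => neg_neg _
    · intro C hC
      simp only [Finset.coe_filter, Set.mem_ofPred_eq, mem_intBox, Pi.neg_apply, abs_neg] at hC ⊢
      exact ⟨hC.1, (hneg C).mpr hC.2.1, (firstPos_neg_iff (hne C hC.2.1)).mpr hC.2.2⟩
    · intro C hC
      simp only [Finset.coe_filter, Set.mem_ofPred_eq, mem_intBox, Pi.neg_apply, abs_neg] at hC ⊢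
      refine ⟨hC.1, (hneg C).mpr hC.2.1, fun h => ?_⟩
      exact (firstPos_neg_iff (hne C hC.2.1)).mp h hC.2.2
  rw [two_mul, ← Finset.card_filter_add_card_filter_not (s := (intBox a).filter P) FirstPos,
    Finset.filter_filter, Finset.filter_filter, h1]

open Classical in
lemma card_inter_box {m : ℕ} {r : Fin m → ℝ} (hr : 0 ≤ r) (S : Set (Fin m → ℤ)) :
    Nat.card ↥(S ∩ box r) = ((intBox fun i => ⌊r i⌋₊).filter (· ∈ S)).card := by
  have : S ∩ box r = ((intBox fun i => ⌊r i⌋₊).filter (· ∈ S) : Finset (Fin m → ℤ)) := by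
    ext x
    simp only [box, Set.mem_inter_iff, Set.mem_ofPred_eq, Finset.coe_filter, mem_intBox, and_comm]
    refine and_congr_right fun _ => forall_congr' fun i => ?_
    rw [Int.abs_eq_natAbs, Int.ofNat_le, Nat.le_floor_iff (hr i), Nat.cast_natAbs, Int.cast_abs]
  rw [this]
  simp

lemma gcd_eq_one_iff_forall_prime {m : ℕ} (C : Fin m → ℤ) :
    Finset.univ.gcd C = 1 ↔ ∀ p : ℕ, p.Prime → ¬ ∀ i, (p : ℤ) ∣ C i := by
  constructor
  · intro h p hp hdvd
    have h1 : (p : ℤ) ∣ Finset.univ.gcd C := Finset.dvd_gcd fun i _ => hdvd i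
    rw [h] at h1
    exact hp.one_lt.ne' (by exact_mod_cast Int.eq_one_of_dvd_one (by positivity) h1)
  · intro h
    have h1 : (Finset.univ.gcd C).natAbs = 1 := by
      by_contra hcon
      obtain ⟨p, hp, hpd⟩ := Nat.exists_prime_and_dvd hcon
      exact h p hp fun i => (Int.natCast_dvd.mpr hpd).trans (Finset.gcd_dvd (Finset.mem_univ i))
    rcases Int.natAbs_eq (Finset.univ.gcd C) with h2 | h2
    · rw [h2, h1]; rfl
    · have h3 := Finset.normalize_gcd (s := Finset.univ) (f := C)
      rw [h2, h1] at h3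
      exact absurd h3 (by decide)

lemma mem_projPts_iff {d : ℕ} {C : Fin (2 * d + 2) → ℤ} : C ∈ projPts d ↔
    (∀ p : ℕ, p.Prime → ¬ ∀ i, (p : ℤ) ∣ C i) ∧ FirstPos C := by
  rw [← gcd_eq_one_iff_forall_prime]
  rfl

lemma resEval_neg (d : ℕ) (C : Fin (2 * d + 2) → ℤ) : resEval d (-C) = resEval d C := by
  have h := resEval_smul d (-1) C
  rw [Even.neg_one_pow (even_two_mul d), one_mul] at h
  rw [← h]
  congr 1
  funext i
  simp

lemma pow_dvd_resEval {d p k : ℕ} (hk : k ≤ 2 * d) {C : Fin (2 * d + 2) → ℤ}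
    (h : ∀ i, (p : ℤ) ∣ C i) : (p : ℤ) ^ k ∣ resEval d C := by
  choose c hc using h
  rw [funext hc, resEval_smul]
  exact (pow_dvd_pow _ hk).mul_right _

lemma mem_VSigma_iff {d : ℕ} (hd : 2 ≤ d) {Sig : Finset ℕ} (hSig : ∀ p ∈ Sig, Nat.Prime p)
    {C : Fin (2 * d + 2) → ℤ} : C ∈ VSigma d Sig ↔
    (∀ p : ℕ, p.Prime → ¬ (p : ℤ) ^ (if p ∈ Sig then 1 else d) ∣ resEval d C) ∧ FirstPos C := by
  constructor
  · rintro ⟨h1, h2, h3⟩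
    refine ⟨fun p hp => ?_, (mem_projPts_iff.mp h1).2⟩
    split_ifs with h
    · rw [pow_one]; exact h2 p h
    · exact h3 p hp
  · rintro ⟨h1, h2⟩
    have h3 : ∀ p ∈ Sig, ¬ (p : ℤ) ∣ resEval d C := fun p hp => by
      simpa [hp] using h1 p (hSig p hp)
    have h4 : ∀ p : ℕ, p.Prime → ¬ (p : ℤ) ^ d ∣ resEval d C := fun p hp => by
      by_cases h : p ∈ Sig
      · exact fun hdvd => h3 p h ((dvd_pow_self _ (by omega)).trans hdvd)
      · simpa [h] using h1 p hp
    exact ⟨mem_projPts_iff.mpr ⟨fun p hp h => h4 p hp (pow_dvd_resEval (by omega) h), h2⟩, h3, h4⟩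

lemma weakRatio_VSigma_eq {d : ℕ} (hd : 2 ≤ d) {Sig : Finset ℕ} (hSig : ∀ p ∈ Sig, Nat.Prime p)
    {r : Fin (2 * d + 2) → ℝ} (hr : 0 ≤ r) : weakRatio d (VSigma d Sig) r =
    boxRatio (fun C : Fin (2 * d + 2) → ℤ => ∀ p : ℕ, p.Prime →
        ¬ (p : ℤ) ^ (if p ∈ Sig then 1 else d) ∣ resEval d C) (fun i => ⌊r i⌋₊) /
      boxRatio (fun C : Fin (2 * d + 2) → ℤ => ∀ p : ℕ, p.Prime → ¬ ∀ i, (p : ℤ) ∣ C i)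
        (fun i => ⌊r i⌋₊) := by
  classical
  have hdvd0 : ∀ p : ℕ, ∀ k ≤ 2 * d, (p : ℤ) ^ k ∣ resEval d (0 : Fin (2 * d + 2) → ℤ) :=
    fun p k hk => pow_dvd_resEval hk fun i => dvd_zero _
  have h1 := two_mul_card_filter_firstPos (P := fun C : Fin (2 * d + 2) → ℤ => ∀ p : ℕ, p.Prime →
    ¬ (p : ℤ) ^ (if p ∈ Sig then 1 else d) ∣ resEval d C) (fun C => by rw [resEval_neg])
    (fun h => h 2 Nat.prime_two (hdvd0 _ _ (by split_ifs <;> omega))) fun i => ⌊r i⌋₊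
  have h2 := two_mul_card_filter_firstPos (P := fun C : Fin (2 * d + 2) → ℤ =>
    ∀ p : ℕ, p.Prime → ¬ ∀ i, (p : ℤ) ∣ C i) (fun C => by simp only [Pi.neg_apply, dvd_neg])
    (fun h => h 2 Nat.prime_two fun i => dvd_zero _) fun i => ⌊r i⌋₊
  simp only [← mem_VSigma_iff hd hSig] at h1
  simp only [← mem_projPts_iff] at h2
  unfold weakRatio boxRatio
  rw [card_inter_box hr, card_inter_box hr, div_div_div_cancel_right₀ (card_intBox_pos _).ne']
  rw [show ∀ x y : ℝ, x / y = (2 * x) / (2 * y) from fun x y =>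
    (mul_div_mul_left x y two_ne_zero).symm]
  congr 1
  · rw [← Nat.cast_ofNat (R := ℝ), ← Nat.cast_mul]
    congr 1
    convert h1.symm
  · rw [← Nat.cast_ofNat (R := ℝ), ← Nat.cast_mul]
    congr 1
    convert h2.symm

lemma prod_piLocal_eq {d : ℕ} {Sig : Finset ℕ} (hSig : ∀ p ∈ Sig, Nat.Prime p) {Z : ℕ}
    (hZ : Sig.sup id ≤ Z) :
    (∏ p ∈ Sig, piLocal d p 1) *
      ∏ p ∈ (Finset.range (Z + 1)).filter (fun p => Nat.Prime p ∧ p ∉ Sig), piLocal d p d =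
    ∏ p ∈ (Finset.range (Z + 1)).filter Nat.Prime, piLocal d p (if p ∈ Sig then 1 else d) := by
  rw [← Finset.prod_filter_mul_prod_filter_not ((Finset.range (Z + 1)).filter Nat.Prime) (· ∈ Sig),
    Finset.filter_filter, Finset.filter_filter]
  congr 1
  · refine Finset.prod_congr ?_ fun p hp => by rw [if_pos (Finset.mem_filter.mp hp).2.2]
    ext p
    simp only [Finset.mem_filter, Finset.mem_range]
    refine ⟨fun hp => ⟨?_, hSig p hp, hp⟩, fun hp => hp.2.2⟩
    exact Nat.lt_succ_of_le ((Finset.le_sup (f := id) hp).trans hZ)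
  · exact Finset.prod_congr rfl fun p hp => by rw [if_neg (Finset.mem_filter.mp hp).2.2]

lemma piLocal_eq_div (d p k : ℕ) : piLocal d p k =
    (Nat.card {Q : Fin (2 * d + 2) → ZMod (p ^ k) // resEval d Q ≠ 0} : ℝ) /
      ((p ^ k : ℕ) : ℝ) ^ (2 * d + 2) / (1 - 1 / (p : ℝ) ^ (2 * d + 2)) := by
  rw [piLocal, div_div, Nat.cast_pow, ← pow_mul, mul_comm k]

/-- the `n`-th weak box density of `V_Σ` exists (lower and upper agree)
and equals `(∏_{p∈Σ} π_p^{(1)})·(∏_{p∉Σ} π_p^{(d)})`. -/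
theorem stmt_14 (d : ℕ) (hd : 2 ≤ d) (n : Fin (2 * d + 2)) (Sig : Finset ℕ)
    (hSig : ∀ p ∈ Sig, Nat.Prime p) :
    ∃ L : ℝ,
      Tendsto (fun Z : ℕ =>
          (∏ p ∈ Sig, piLocal d p 1) *
            ∏ p ∈ (Finset.range (Z + 1)).filter (fun p => Nat.Prime p ∧ p ∉ Sig),
              piLocal d p d) atTop (nhds L) ∧
      liminf (fun s : Fin (2 * d + 2) → ℝ =>
          liminf (fun t : ℝ => weakRatio d (VSigma d Sig) (Function.update s n t)) atTop)
        atTop = L ∧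
      limsup (fun s : Fin (2 * d + 2) → ℝ =>
          limsup (fun t : ℝ => weakRatio d (VSigma d Sig) (Function.update s n t)) atTop)
        atTop = L := by

  obtain ⟨α, hα, hα'⟩ := tendsto_boxRatio_resEval hd n
    (k := fun p => if p ∈ Sig then 1 else d) (K := Sig.sup id) fun p hp =>
      if_neg fun h => (Finset.le_sup (f := id) h).not_gt hp
  obtain ⟨β, hβ0, hβ, hβ'⟩ := tendsto_boxRatio_primitive (m := 2 * d + 1) (by omega) n
  have hlim : Tendsto (weakRatio d (VSigma d Sig)) (boxFilter n) (nhds (α / β)) := by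
    refine (hα'.div hβ' hβ0.ne').congr' ?_
    filter_upwards [boxFilter_le_atTop n (eventually_ge_atTop 0)] with r hr
    exact (weakRatio_VSigma_eq hd hSig hr).symm
  refine ⟨α / β, (hα.div hβ hβ0.ne').congr' ?_, liminf_limsup_boxFilter n hlim⟩
  filter_upwards [eventually_ge_atTop (Sig.sup id)] with Z hZ
  rw [prod_piLocal_eq hSig hZ, Pi.div_apply, ← Finset.prod_div_distrib]
  exact Finset.prod_congr rfl fun p _ => (piLocal_eq_div d p _).symm
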